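/- arXiv:2409.17375 — 2 statements merged into one kernel-verified Lean document; each statement's English description precedes it below -/
import Mathlib

section
/- Let 2 ≤ l ≤ m ≤ n be integers with m > 2 and n > 2. Then the right-angled Artin group A(P_4) embeds as a subgroup into the triangle Artin group A(Δ_{l,m,n}); indeed, writing z_{bc} = (b,c)_m and z_{ac} = (a,c)_n, the subgroup of A(Δ_{l,m,n}) generated by b², z_{bc}², c², z_{ac}² is isomorphic to A(P_4). -/
/-- The alternating product `u v u v …` of length `m`. -/
def altProd {G : Type*} [Monoid G] (u v : G) (m : ℕ) : G :=
  ((List.range m).map (fun i => if i % 2 = 0 then u else v)).prod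

/-- Relations of the Artin group of an Artin graph `(G, ℓ)`:
`(u,v)_{ℓ u v} = (v,u)_{ℓ u v}` for each edge `{u,v}`. -/
def artinRels {V : Type*} (G : SimpleGraph V) (ℓ : V → V → ℕ) : Set (FreeGroup V) :=
  {r | ∃ u v : V, G.Adj u v ∧
    r = altProd (FreeGroup.of u) (FreeGroup.of v) (ℓ u v) *
        (altProd (FreeGroup.of v) (FreeGroup.of u) (ℓ u v))⁻¹}

/-- The Artin group of an Artin graph `(G, ℓ)`. -/
abbrev ArtinGroup {V : Type*} (G : SimpleGraph V) (ℓ : V → V → ℕ) :=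
  PresentedGroup (artinRels G ℓ)

/-- Relations of the right-angled Artin group of a simplicial graph: commutators of adjacent vertices. -/
def raagRels {V : Type*} (G : SimpleGraph V) : Set (FreeGroup V) :=
  {r | ∃ u v : V, G.Adj u v ∧
    r = FreeGroup.of u * FreeGroup.of v * (FreeGroup.of u)⁻¹ * (FreeGroup.of v)⁻¹}

/-- The right-angled Artin group of a simplicial graph. -/
abbrev RAAG {V : Type*} (G : SimpleGraph V) := PresentedGroup (raagRels G)

/-- Labels for the triangle `Δ_{l,m,n}` on vertices `a = 0, b = 1, c = 2`: the edge `{a, b}`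
is labeled `l`, the edge `{b, c}` is labeled `m`, and the edge `{a, c}` is labeled `n`. -/
def triLabel (l m n : ℕ) : Fin 3 → Fin 3 → ℕ := fun i j =>
  if (i = 0 ∧ j = 1) ∨ (i = 1 ∧ j = 0) then l
  else if (i = 1 ∧ j = 2) ∨ (i = 2 ∧ j = 1) then m
  else n


section
open Real

namespace TriArt

theorem altProd_zero {G : Type*} [Monoid G] (u v : G) : altProd u v 0 = 1 := by
  simp [altProd]

theorem altProd_succ {G : Type*} [Monoid G] (u v : G) (n : ℕ) :
    altProd u v (n + 1) = u * altProd v u n := by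
  unfold altProd
  rw [List.range_succ_eq_map, List.map_cons, List.prod_cons, List.map_map]
  simp only [Nat.zero_mod, if_true]
  congr 2
  apply List.map_congr_left
  intro i _
  simp only [Function.comp]
  rcases Nat.mod_two_eq_zero_or_one i with h | h
  · have : (i + 1) % 2 = 1 := by omega
    simp [h, this]
  · have : (i + 1) % 2 = 0 := by omega
    simp [h, this]

theorem altProd_succ' {G : Type*} [Monoid G] (u v : G) (n : ℕ) :
    altProd u v (n + 1) = altProd u v n * (if n % 2 = 0 then u else v) := by
  unfold altProd
  rw [List.range_succ, List.map_append, List.prod_append]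
  simp

theorem map_altProd {G H : Type*} [Monoid G] [Monoid H] (f : G →* H) (u v : G) (n : ℕ) :
    f (altProd u v n) = altProd (f u) (f v) n := by
  induction n generalizing u v with
  | zero => simp [altProd_zero]
  | succ n ih => rw [altProd_succ, altProd_succ, map_mul, ih]

theorem altProd_double {G : Type*} [Monoid G] (u v : G) (n : ℕ) :
    altProd u v (2 * n) = (u * v) ^ n := by
  induction n with
  | zero => simp [altProd_zero]
  | succ n ih =>
    rw [show 2 * (n + 1) = (2 * n + 1) + 1 by ring, altProd_succ, altProd_succ, ih, pow_succ',
      mul_assoc]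

theorem altProd_add {G : Type*} [Monoid G] (u v : G) (n k : ℕ) :
    altProd u v (n + k) = altProd u v n * (if n % 2 = 0 then altProd u v k else altProd v u k) := by
  induction n generalizing u v with
  | zero => simp [altProd_zero]
  | succ n ih =>
    rw [show n + 1 + k = (n + k) + 1 by ring, altProd_succ, altProd_succ, ih, mul_assoc]
    rcases Nat.mod_two_eq_zero_or_one n with h | h
    · have h2 : (n + 1) % 2 = 1 := by omega
      simp [h, h2]
    · have h2 : (n + 1) % 2 = 0 := by omega
      simp [h, h2]

/-- The real vector space carrying the geometric representation. -/
abbrev V := Fin 3 → ℝ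

/-- Simple root. -/
noncomputable def e (i : Fin 3) : V := Pi.single i 1

variable (M : CoxeterMatrix (Fin 3))

/-- Coefficients of the form. -/
noncomputable def K (i j : Fin 3) : ℝ := 2 * cos (π / M i j)

/-- minus twice the form with a simple root. -/
noncomputable def bil (i : Fin 3) : V →ₗ[ℝ] ℝ :=
  ∑ j, (if j = i then (-2 : ℝ) else K M i j) • LinearMap.proj j

/-- Reflection. -/
noncomputable def S (i : Fin 3) : Module.End ℝ V :=
  LinearMap.id + (bil M i).smulRight (e i)

theorem S_apply (i : Fin 3) (v : V) : S M i v = v + bil M i v • e i := rfl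

theorem bil_apply (i : Fin 3) (v : V) :
    bil M i v = ∑ j, (if j = i then (-2 : ℝ) else K M i j) * v j := by
  simp only [bil, LinearMap.sum_apply, LinearMap.smul_apply, LinearMap.proj_apply, smul_eq_mul]

theorem bil_self (i : Fin 3) : bil M i (e i) = -2 := by
  rw [bil_apply, Finset.sum_eq_single i] <;> simp +contextual [e]

theorem bil_ne {i j : Fin 3} (h : i ≠ j) : bil M i (e j) = K M i j := by
  rw [bil_apply, Finset.sum_eq_single j] <;> simp +contextual [e, h.symm]

theorem K_symm (i j : Fin 3) : K M i j = K M j i := by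
  unfold K; rw [M.symmetric]

theorem S_S (i : Fin 3) (v : V) : S M i (S M i v) = v := by
  rw [S_apply, S_apply, map_add, map_smul, bil_self, smul_eq_mul]
  module

theorem S_mul_S (i : Fin 3) : S M i * S M i = 1 := by
  exact LinearMap.ext fun v => S_S M i v

/-- Rule in the plane. -/
theorem S_plane {i j : Fin 3} (h : i ≠ j) (p q : ℝ) :
    S M i (p • e i + q • e j) = (K M i j * q - p) • e i + q • e j := by
  rw [S_apply, map_add, map_smul, map_smul, bil_self, bil_ne M h]
  simp only [smul_eq_mul]
  module

/-- Chebyshev type sequence. -/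
noncomputable def U (m : ℕ) (n : ℕ) : ℝ := sin (n * (π / m)) / sin (π / m)

section
variable {m : ℕ}

theorem theta_pos (hm : 2 ≤ m) : 0 < π / m := by
  have : (0 : ℝ) < m := by exact_mod_cast (by omega : 0 < m)
  positivity

theorem theta_le (hm : 2 ≤ m) : π / m ≤ π / 2 := by
  have : (2 : ℝ) ≤ m := by exact_mod_cast hm
  have := pi_pos
  gcongr

theorem sin_theta_pos (hm : 2 ≤ m) : 0 < sin (π / m) :=
  sin_pos_of_pos_of_lt_pi (theta_pos hm) (by have := theta_le hm; have := pi_pos; linarith)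

theorem U_zero : U m 0 = 0 := by simp [U]

theorem U_one (hm : 2 ≤ m) : U m 1 = 1 := by
  have := sin_theta_pos hm
  simp [U, this.ne']

theorem U_rec (hm : 2 ≤ m) (n : ℕ) : U m (n + 2) = 2 * cos (π / m) * U m (n + 1) - U m n := by
  have := sin_theta_pos hm
  unfold U
  field_simp
  push_cast
  have e1 : sin ((n + 2) * (π / m)) = sin ((n + 1) * (π / m)) * cos (π / m) + cos ((n + 1) * (π / m)) * sin (π / m) := by
    rw [← sin_add]; ring_nf
  have e2 : sin (n * (π / m)) = sin ((n + 1) * (π / m)) * cos (π / m) - cos ((n + 1) * (π / m)) * sin (π / m) := by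
    rw [← sin_sub]; ring_nf
  have a1 : (n + 2) * π / m = (n + 2) * (π / m) := by ring
  have a2 : π * (n + 1) / m = (n + 1) * (π / m) := by ring
  have a3 : π * n / m = n * (π / m) := by ring
  rw [a1, a2, a3]
  rw [e1, e2]; ring

theorem U_nonneg (hm : 2 ≤ m) {n : ℕ} (hn : n ≤ m) : 0 ≤ U m n := by
  have := sin_theta_pos hm
  unfold U
  apply div_nonneg _ this.le
  have h0 : (0 : ℝ) < m := by exact_mod_cast (by omega : 0 < m)
  apply sin_nonneg_of_nonneg_of_le_pi
  · have := theta_pos hm; positivity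
  · have : (n : ℝ) ≤ m := by exact_mod_cast hn
    calc n * (π / m) ≤ m * (π / m) := by
          have := theta_pos hm
          gcongr
      _ = π := by field_simp

theorem U_m (hm : 2 ≤ m) : U m m = 0 := by
  have h0 : (m : ℝ) ≠ 0 := by exact_mod_cast (by omega : m ≠ 0)
  unfold U
  rw [mul_div_cancel₀ _ h0]; simp

theorem U_m_succ (hm : 2 ≤ m) : U m (m + 1) = -1 := by
  have := sin_theta_pos hm
  have h0 : (m : ℝ) ≠ 0 := by exact_mod_cast (by omega : m ≠ 0)
  unfold U
  rw [div_eq_iff this.ne']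
  have : ((m + 1 : ℕ) : ℝ) * (π / m) = π / m + π := by push_cast; field_simp; ring
  rw [this, sin_add_pi]; ring

theorem U_m_pred (hm : 2 ≤ m) {k : ℕ} (hk : m = k + 1) : U m k = 1 := by
  have := U_rec hm k
  rw [← hk, U_m hm, show k + 2 = m + 1 by omega, U_m_succ hm] at this
  linarith

theorem cos_nonneg' (hm : 2 ≤ m) : 0 ≤ cos (π / m) :=
  cos_nonneg_of_neg_pi_div_two_le_of_le (by have := theta_pos hm; have := pi_pos; linarith) (theta_le hm)

theorem cos_sq_lt (hm : 2 ≤ m) : cos (π / m) ^ 2 < 1 := by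
  have := sin_theta_pos hm
  have := sin_sq_add_cos_sq (π / m)
  nlinarith
end

variable (hM : ∀ i j, i ≠ j → 2 ≤ M i j)

theorem K_nonneg (hM : ∀ i j, i ≠ j → 2 ≤ M i j) {i j : Fin 3} (h : i ≠ j) : 0 ≤ K M i j := by
  have := cos_nonneg' (hM i j h); unfold K; positivity

theorem K_sq_lt (hM : ∀ i j, i ≠ j → 2 ≤ M i j) {i j : Fin 3} (h : i ≠ j) : K M i j ^ 2 < 4 := by
  have := cos_sq_lt (hM i j h); unfold K; nlinarith

theorem alt_formula (hM : ∀ i j, i ≠ j → 2 ≤ M i j) {i j : Fin 3} (h : i ≠ j) (n : ℕ) :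
    altProd (S M i) (S M j) n (if n % 2 = 0 then e i else e j) =
      U (M i j) (n + 1) • e i + U (M i j) n • e j := by
  induction n generalizing i j with
  | zero => simp [altProd_zero, U_zero, U_one (hM i j h)]
  | succ n ih =>
    have h1 : (if (n + 1) % 2 = 0 then e i else e j) = (if n % 2 = 0 then e j else e i) := by
      rcases Nat.mod_two_eq_zero_or_one n with h | h
      · have h2 : (n + 1) % 2 = 1 := by omega
        simp [h, h2]
      · have h2 : (n + 1) % 2 = 0 := by omega
        simp [h, h2]
    rw [altProd_succ, h1, Module.End.mul_apply, ih h.symm, add_comm, S_plane M h,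
      M.symmetric j i, U_rec (hM i j h)]
    rfl

theorem alt_formula' (hM : ∀ i j, i ≠ j → 2 ≤ M i j) {i j : Fin 3} (h : i ≠ j) (n : ℕ) :
    altProd (S M i) (S M j) (n + 1) (if n % 2 = 0 then e i else e j) =
      -(U (M i j) (n + 1) • e i + U (M i j) n • e j) := by
  rw [altProd_succ', Module.End.mul_apply, ← alt_formula M hM h, ← map_neg]
  congr 1
  have key : ∀ i, S M i (e i) = - e i := by
    intro i; rw [S_apply, bil_self]; module
  split_ifs <;> exact key _

/-- The longest element on the plane. -/
theorem alt_long (hM : ∀ i j, i ≠ j → 2 ≤ M i j) {i j : Fin 3} (h : i ≠ j) (p q : ℝ) :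
    altProd (S M i) (S M j) (M i j) (p • e i + q • e j) =
      if M i j % 2 = 0 then -(p • e i + q • e j) else -(q • e i + p • e j) := by
  have h2 := hM i j h
  obtain ⟨k, hk⟩ : ∃ k, M i j = k + 1 := ⟨M i j - 1, by omega⟩
  have f1 := alt_formula M hM h (M i j)
  have f2 := alt_formula' M hM h k
  rw [U_m h2, U_m_succ h2] at f1
  rw [← hk, U_m h2, U_m_pred h2 hk] at f2
  rw [map_add, map_smul, map_smul]
  rcases Nat.mod_two_eq_zero_or_one (M i j) with h' | h'
  · have h3 : k % 2 = 1 := by omega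
    simp [h', h3] at f1 f2 ⊢
    rw [f1, f2]; module
  · have h3 : k % 2 = 0 := by omega
    simp [h', h3] at f1 f2 ⊢
    rw [f1, f2]; module

theorem decomp (hM : ∀ i j, i ≠ j → 2 ≤ M i j) {i j : Fin 3} (h : i ≠ j) (v : V) : ∃ v' : V, ∃ p q : ℝ,
    v = v' + (p • e i + q • e j) ∧ bil M i v' = 0 ∧ bil M j v' = 0 := by
  have hk := K_sq_lt M hM h
  set k := K M i j with hkd
  have h4 : 4 - k ^ 2 ≠ 0 := by linarith
  refine ⟨v - ((-(2 * bil M i v + k * bil M j v) / (4 - k ^ 2)) • e i +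
    (-(2 * bil M j v + k * bil M i v) / (4 - k ^ 2)) • e j), _, _, (sub_add_cancel _ _).symm, ?_, ?_⟩
  · rw [map_sub, map_add, map_smul, map_smul, bil_self, bil_ne M h, ← hkd]
    simp only [smul_eq_mul]; field_simp; ring
  · rw [map_sub, map_add, map_smul, map_smul, bil_self, bil_ne M h.symm, K_symm M j i, ← hkd]
    simp only [smul_eq_mul]; field_simp; ring

theorem alt_fix {i j : Fin 3} {v : V} (hi : bil M i v = 0) (hj : bil M j v = 0) (n : ℕ) :
    altProd (S M i) (S M j) n v = v := by
  induction n generalizing i j with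
  | zero => simp [altProd_zero]
  | succ n ih => rw [altProd_succ, Module.End.mul_apply, ih hj hi, S_apply, hi]; simp

theorem S_braid (hM : ∀ i j, i ≠ j → 2 ≤ M i j) {i j : Fin 3} (h : i ≠ j) :
    altProd (S M i) (S M j) (M i j) = altProd (S M j) (S M i) (M i j) := by
  refine LinearMap.ext fun v => ?_
  obtain ⟨v', p, q, rfl, h1, h2⟩ := decomp M hM h v
  rw [map_add _ v', map_add _ v', alt_fix M h1 h2, alt_fix M h2 h1, alt_long M hM h]
  have := alt_long M hM h.symm q p
  rw [M.symmetric j i, add_comm (q • e j)] at this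
  rw [this]
  split_ifs <;> module

theorem S_liftable (hM : ∀ i j, i ≠ j → 2 ≤ M i j) : M.IsLiftable (S M) := by
  intro i j
  by_cases h : i = j
  · subst h; rw [S_mul_S]; simp
  rw [← altProd_double, two_mul, altProd_add, ← S_braid M hM h, ite_self]
  refine LinearMap.ext fun v => ?_
  obtain ⟨v', p, q, rfl, h1, h2⟩ := decomp M hM h v
  rw [Module.End.mul_apply, map_add, map_add, alt_fix M h1 h2, alt_fix M h1 h2, alt_long M hM h]
  simp only [Module.End.one_apply]
  congr 1
  split_ifs with h5
  · rw [map_neg, alt_long M hM h, if_pos h5, neg_neg]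
  · rw [map_neg, alt_long M hM h, if_neg h5, neg_neg]

end TriArt
end

section
open Real
namespace TriArt
open CoxeterSystem

variable (M : CoxeterMatrix (Fin 3))

/-- The Coxeter system. -/
noncomputable abbrev cs := M.toCoxeterSystem

variable (hM : ∀ i j, i ≠ j → 2 ≤ M i j)

/-- Geometric representation. -/
noncomputable def rho : M.Group →* Module.End ℝ V := (cs M).lift ⟨S M, S_liftable M hM⟩

theorem rho_simple (i : Fin 3) : rho M hM ((cs M).simple i) = S M i :=
  (cs M).lift_apply_simple _ i

theorem alt_word_aux (hM : ∀ i j, i ≠ j → 2 ≤ M i j) {s t : Fin 3} (h : s ≠ t) (k : ℕ) :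
    rho M hM ((cs M).wordProd (alternatingWord s t k)) (e s) =
      if Even k then U (M s t) (k + 1) • e s + U (M s t) k • e t
      else U (M s t) k • e s + U (M s t) (k + 1) • e t := by
  induction k with
  | zero => simp [alternatingWord, U_zero, U_one (hM s t h)]
  | succ k ih =>
    rw [alternatingWord_succ', wordProd_cons, map_mul, Module.End.mul_apply, ih, rho_simple]
    by_cases hk : Even k
    · have hk' : ¬ Even (k + 1) := by simpa [Nat.even_add_one] using hk
      simp only [hk, hk', if_true, if_false]
      rw [add_comm, S_plane M h.symm, U_rec (hM s t h), K_symm M t s, K]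
      exact add_comm _ _
    · have hk' : Even (k + 1) := by simpa [Nat.even_add_one] using hk
      simp only [hk, hk', if_true, if_false]
      rw [S_plane M h, U_rec (hM s t h), K]

theorem alt_word_pos (hM : ∀ i j, i ≠ j → 2 ≤ M i j) {s t : Fin 3} (h : s ≠ t) {k : ℕ} (hk : k < M s t) : ∃ p q : ℝ, 0 ≤ p ∧ 0 ≤ q ∧
    rho M hM ((cs M).wordProd (alternatingWord s t k)) (e s) = p • e s + q • e t := by
  rw [alt_word_aux M hM h]
  have h1 := U_nonneg (hM s t h) (n := k) hk.le
  have h2 := U_nonneg (hM s t h) (n := k + 1) hk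
  split_ifs
  · exact ⟨_, _, h2, h1, rfl⟩
  · exact ⟨_, _, h1, h2, rfl⟩

theorem coset_aux (hM : ∀ i j, i ≠ j → 2 ≤ M i j) {s t : Fin 3} (h : s ≠ t) (w : M.Group) (hs : ¬ (cs M).IsRightDescent w s)
    (ht : (cs M).IsRightDescent w t) :
    ∃ k v, k < M s t ∧ 0 < k ∧ w = v * (cs M).wordProd (alternatingWord s t k) ∧
      (cs M).length v + k = (cs M).length w ∧ ¬ (cs M).IsRightDescent v s ∧
      ¬ (cs M).IsRightDescent v t := by
  classical
  let P : ℕ → Prop := fun k => ∃ v, w = v * (cs M).wordProd (alternatingWord s t k) ∧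
      (cs M).length v + k = (cs M).length w
  have P1 : P 1 := by
    refine ⟨w * (cs M).simple t, ?_, ?_⟩
    · rw [alternatingWord_succ', wordProd_cons]
      simp only [alternatingWord, wordProd_nil, mul_one, Even.zero, if_true]
      rw [mul_assoc, simple_mul_simple_self, mul_one]
    · exact (cs M).isRightDescent_iff.1 ht
  have Pdown : ∀ k, P (k + 1) → P k := by
    rintro k ⟨v, hv, hl⟩
    rw [alternatingWord_succ', wordProd_cons, ← mul_assoc] at hv
    refine ⟨_, hv, ?_⟩
    have h1 := (cs M).length_mul_simple v (if Even k then t else s)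
    have h2 := (cs M).length_mul_le (v * (cs M).simple (if Even k then t else s))
      ((cs M).wordProd (alternatingWord s t k))
    have h3 := (cs M).length_wordProd_le (alternatingWord s t k)
    rw [← hv] at h2
    rw [length_alternatingWord] at h3
    omega
  have Pdown' : ∀ k j, P (k + j) → P k := by
    intro k j
    induction j with
    | zero => exact id
    | succ j ih => intro hh; exact ih (Pdown _ hh)
  have PM : ¬ P (M s t) := by
    rintro ⟨v, hv, hl⟩
    have hb := (cs M).wordProd_braidWord_eq s t
    unfold braidWord at hb
    rw [hb] at hv
    have h2 : M t s ≠ 0 := by have := hM t s h.symm; omega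
    obtain ⟨r, hr⟩ := Nat.exists_eq_succ_of_ne_zero h2
    rw [hr, Nat.succ_eq_add_one, alternatingWord_succ, wordProd_concat, ← mul_assoc] at hv
    have h3 := (cs M).length_mul_le v ((cs M).wordProd (alternatingWord s t r))
    have h4 := (cs M).length_wordProd_le (alternatingWord s t r)
    rw [length_alternatingWord] at h4
    apply hs
    unfold IsRightDescent
    rw [hv]
    simp only [simple_mul_simple_cancel_right]
    rw [← hv]
    rw [M.symmetric s t] at hl
    omega
  have h2M := hM s t h
  have hk : P (Nat.findGreatest P (M s t)) :=
    Nat.findGreatest_spec (m := 1) (by omega) P1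
  have hk1 : 1 ≤ Nat.findGreatest P (M s t) := Nat.le_findGreatest (by omega) P1
  have hkm : Nat.findGreatest P (M s t) < M s t := by
    rcases (Nat.findGreatest_le (P := P) (M s t)).lt_or_eq with h' | h'
    · exact h'
    · rw [h'] at hk; exact absurd hk PM
  have hkS : ¬ P (Nat.findGreatest P (M s t) + 1) :=
    Nat.findGreatest_is_greatest (by omega) hkm
  generalize Nat.findGreatest P (M s t) = k at *
  obtain ⟨v, hv, hl⟩ := hk
  have hA : ¬ (cs M).IsRightDescent v (if Even k then t else s) := by
    intro hd
    apply hkS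
    refine ⟨v * (cs M).simple (if Even k then t else s), ?_, ?_⟩
    · rw [alternatingWord_succ', wordProd_cons, mul_assoc, simple_mul_simple_cancel_left]
      exact hv
    · have := (cs M).isRightDescent_iff.1 hd
      omega
  have hB : ¬ (cs M).IsRightDescent v (if Even k then s else t) := by
    intro hd
    obtain ⟨r, rfl⟩ := Nat.exists_eq_succ_of_ne_zero (by omega : k ≠ 0)
    rw [Nat.succ_eq_add_one, alternatingWord_succ', wordProd_cons, ← mul_assoc] at hv
    have e1 : (if Even r.succ then s else t) = (if Even r then t else s) := by
      by_cases hr : Even r <;> simp [Nat.even_add_one, hr]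
    rw [e1] at hd
    have h3 := (cs M).isRightDescent_iff.1 hd
    have h4 := (cs M).length_mul_le (v * (cs M).simple (if Even r then t else s))
      ((cs M).wordProd (alternatingWord s t r))
    rw [← hv] at h4
    have h5 := (cs M).length_wordProd_le (alternatingWord s t r)
    rw [length_alternatingWord] at h5
    omega
  refine ⟨k, v, hkm, hk1, hv, hl, ?_⟩
  by_cases hk : Even k
  · simp only [hk, if_true] at hA hB; exact ⟨hB, hA⟩
  · simp only [hk, if_false] at hA hB; exact ⟨hA, hB⟩

theorem e_nonneg (i : Fin 3) : 0 ≤ e i := by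
  unfold e; intro j; by_cases h : j = i
  · subst h; simp
  · simp [h]

theorem e_ne (i : Fin 3) : e i ≠ 0 := by
  intro h; have := congrFun h i; simp [e] at this

theorem root_pos (w : M.Group) (s : Fin 3) (hs : ¬ (cs M).IsRightDescent w s) :
    0 ≤ rho M hM w (e s) := by
  induction hn : (cs M).length w using Nat.strong_induction_on generalizing w s with
  | _ N ih =>
    subst hn
    by_cases h1 : w = 1
    · subst h1; simpa using e_nonneg s
    obtain ⟨t, ht⟩ := (cs M).exists_rightDescent_of_ne_one h1
    have hst : s ≠ t := by rintro rfl; exact hs ht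
    obtain ⟨k, v, hk, hk0, rfl, hl, hvs, hvt⟩ := coset_aux M hM hst w hs ht
    obtain ⟨p, q, hp, hq, hpq⟩ := alt_word_pos M hM hst hk
    rw [map_mul, Module.End.mul_apply, hpq, map_add, map_smul, map_smul]
    have i1 := ih _ (by omega) v s hvs rfl
    have i2 := ih _ (by omega) v t hvt rfl
    exact add_nonneg (smul_nonneg hp i1) (smul_nonneg hq i2)

/-- A vector all of whose translates have constant sign. -/
def Good (v : V) : Prop := v ≠ 0 ∧ ∀ w : M.Group, 0 ≤ rho M hM w v ∨ rho M hM w v ≤ 0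

variable {M hM}

theorem Good.rho {v : V} (hv : Good M hM v) (w : M.Group) : Good M hM (rho M hM w v) := by
  refine ⟨?_, fun w' => ?_⟩
  · intro h
    apply hv.1
    have := congrArg (TriArt.rho M hM w⁻¹) h
    rwa [← Module.End.mul_apply, ← map_mul, inv_mul_cancel, map_one, map_zero] at this
  · rw [← Module.End.mul_apply, ← map_mul]; exact hv.2 _

theorem Good.S {v : V} (hv : Good M hM v) (i : Fin 3) : Good M hM (S M i v) := by
  rw [← rho_simple M hM]; exact hv.rho _

theorem Good.of_S {v : V} (i : Fin 3) (hv : Good M hM (TriArt.S M i v)) : Good M hM v := by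
  have := hv.S i; rwa [S_S] at this

theorem Good.smul {v : V} (hv : Good M hM v) {c : ℝ} (hc : 0 < c) : Good M hM (c • v) := by
  refine ⟨smul_ne_zero hc.ne' hv.1, fun w => ?_⟩
  rw [map_smul]
  rcases hv.2 w with h | h
  · exact Or.inl (smul_nonneg hc.le h)
  · exact Or.inr (smul_nonpos_of_nonneg_of_nonpos hc.le h)

theorem Good.neg {v : V} (hv : Good M hM v) : Good M hM (-v) := by
  refine ⟨neg_ne_zero.2 hv.1, fun w => ?_⟩
  rw [map_neg]
  rcases hv.2 w with h | h
  · exact Or.inr (neg_nonpos.2 h)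
  · exact Or.inl (neg_nonneg.2 h)

theorem Good.sign {v : V} (hv : Good M hM v) : 0 ≤ v ∨ v ≤ 0 := by
  simpa using hv.2 1

theorem good_e (s : Fin 3) : Good M hM (e s) := by
  refine ⟨e_ne s, fun w => ?_⟩
  by_cases hs : (cs M).IsRightDescent w s
  · right
    have h1 : ¬ (cs M).IsRightDescent (w * (cs M).simple s) s :=
      (cs M).isRightDescent_iff_not_isRightDescent_mul.1 hs
    have := root_pos M hM _ _ h1
    rw [map_mul, Module.End.mul_apply, rho_simple, S_apply, bil_self] at this
    have e1 : e s + (-2 : ℝ) • e s = - e s := by module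
    rw [e1, map_neg] at this
    exact neg_nonneg.1 this
  · exact Or.inl (root_pos M hM _ _ hs)

theorem good_antidominant {v : V} (hv : 0 ≤ v) (h0 : v ≠ 0) (hb : ∀ s, 0 ≤ bil M s v) :
    Good M hM v := by
  refine ⟨h0, fun w => Or.inl ?_⟩
  induction hn : (cs M).length w using Nat.strong_induction_on generalizing w with
  | _ N ih =>
    subst hn
    by_cases h1 : w = 1
    · subst h1; simpa using hv
    obtain ⟨t, ht⟩ := (cs M).exists_rightDescent_of_ne_one h1
    have h2 : ¬ (cs M).IsRightDescent (w * (cs M).simple t) t :=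
      (cs M).isRightDescent_iff_not_isRightDescent_mul.1 ht
    have h3 := root_pos M hM _ _ h2
    have h4 := ih _ ht (w * (cs M).simple t) rfl
    have h5 : w = w * (cs M).simple t * (cs M).simple t :=
      ((cs M).simple_mul_simple_cancel_right t).symm
    rw [h5, map_mul, Module.End.mul_apply, rho_simple, S_apply, map_add, map_smul]
    exact add_nonneg h4 (smul_nonneg (hb t) h3)

/-- Only multiples of the simple root change sign. -/
theorem flip_simple {v : V} {s : Fin 3} (h : 0 ≤ v) (h' : S M s v ≤ 0) : v = v s • e s := by
  funext j
  by_cases hj : j = s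
  · subst hj; simp [e]
  · have h1 := h j
    have h2 := h' j
    rw [S_apply] at h2
    simp [e, hj] at h1 h2 ⊢
    linarith

end TriArt
end

section
namespace TriArt

/-- The free group acted upon. -/
abbrev F := FreeGroup (Fin 3)

/-- Strand labels; the strand 0 has trivial label. -/
def y : Fin 4 → F := Fin.cases 1 FreeGroup.of

theorem y_zero : y 0 = 1 := rfl
theorem y_succ (i : Fin 3) : y i.succ = FreeGroup.of i := rfl

open Classical in
/-- Strands sorted by decreasing height. -/
noncomputable def L (h : Fin 4 → ℝ) : List (Fin 4) :=
  (List.finRange 4).mergeSort (fun i j => decide (h j ≤ h i))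

theorem L_perm (h : Fin 4 → ℝ) : (L h).Perm (List.finRange 4) := List.mergeSort_perm _ _

theorem L_nodup (h : Fin 4 → ℝ) : (L h).Nodup := (L_perm h).nodup_iff.2 (List.nodup_finRange 4)

theorem mem_L (h : Fin 4 → ℝ) (i : Fin 4) : i ∈ L h := (L_perm h).mem_iff.2 (List.mem_finRange i)

theorem L_pairwise {h : Fin 4 → ℝ} (hi : Function.Injective h) :
    (L h).Pairwise (fun i j => h j < h i) := by
  have h1 : (L h).Pairwise (fun i j => h j ≤ h i) := by
    have := List.pairwise_mergeSort (le := fun i j => decide (h j ≤ h i)) (l := List.finRange 4)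
      (by simp only [decide_eq_true_eq]; intro a b c h1 h2; exact h2.trans h1)
      (by simp only [Bool.or_eq_true, decide_eq_true_eq]; intro a b; exact le_total _ _)
    simpa [L] using this
  have h2 := L_nodup h
  refine (h1.and h2).imp ?_
  rintro a b ⟨h3, h4⟩
  exact lt_of_le_of_ne h3 (fun h5 => h4 (hi h5).symm)

theorem L_eq {h : Fin 4 → ℝ} {l : List (Fin 4)} (hl : l.Perm (List.finRange 4))
    (hp : l.Pairwise (fun i j => h j < h i)) (hi : Function.Injective h) : L h = l := by
  refine List.Perm.eq_of_pairwise ?_ (L_pairwise hi) hp ((L_perm h).trans hl.symm)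
  intro a b _ _ h1 h2
  exact absurd h1 (not_lt.2 h2.le)

open Classical in
/-- The conjugating words. -/
noncomputable def Wd (h h' : Fin 4 → ℝ) (j : Fin 4) : F :=
  (((L h).filter (fun i => decide (h j < h i ∧ h' i < h' j))).map y).prod

/-- The automorphism. -/
noncomputable def phi (h h' : Fin 4 → ℝ) : F →* F :=
  FreeGroup.lift (fun i => Wd h h' i.succ * FreeGroup.of i * (Wd h h' i.succ)⁻¹)

theorem phi_y (h h' : Fin 4 → ℝ) (j : Fin 4) : phi h h' (y j) = Wd h h' j * y j * (Wd h h' j)⁻¹ := by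
  refine Fin.cases ?_ (fun i => ?_) j
  · simp [y_zero]
  · simp [y_succ, phi]

/-- The affine map. -/
noncomputable def Mh (h h' : Fin 4 → ℝ) (f : F) : F := phi h h' f * Wd h h' 0

/-- The heights differ by a single flip. -/
def Flip (h' hBB : Fin 4 → ℝ) (a b : Fin 4) : Prop :=
  h' b < h' a ∧ hBB a < hBB b ∧
    ∀ i j, ¬ (i = a ∧ j = b) → ¬ (i = b ∧ j = a) → (h' i < h' j ↔ hBB i < hBB j)

/-- The heights have the same order. -/
def Same (h' hBB : Fin 4 → ℝ) : Prop := ∀ i j, (h' i < h' j ↔ hBB i < hBB j)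

theorem Wd_same {h h' : Fin 4 → ℝ} (hs : Same h h') (j : Fin 4) : Wd h h' j = 1 := by
  unfold Wd
  rw [List.filter_eq_nil_iff.2]
  · rfl
  · intro i _
    simp only [decide_eq_true_eq, not_and, not_lt]
    intro h1
    exact ((hs _ _).1 h1).le

theorem Wd_flip {h h' : Fin 4 → ℝ} {a b : Fin 4} (hs : Flip h h' a b) (j : Fin 4) :
    Wd h h' j = if j = b then y a else 1 := by
  obtain ⟨h1, h2, h3⟩ := hs
  unfold Wd
  split_ifs with hj
  · subst hj
    have : (L h).filter (fun i => decide (h j < h i ∧ h' i < h' j)) =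
        (L h).filter (fun i => decide (i = a)) := by
      apply List.filter_congr
      intro i _
      rw [decide_eq_decide]
      constructor
      · rintro ⟨h4, h5⟩
        by_contra hia
        have h6 := (h3 j i (by rintro ⟨rfl, rfl⟩; exact lt_irrefl _ h4) (by tauto)).1 h4
        exact lt_asymm h5 h6
      · rintro rfl; exact ⟨h1, h2⟩
    rw [this]
    have h7 : (L h).filter (fun i => decide (i = a)) = [a] := by
      have := List.filter_eq (l := L h) a
      rw [List.count_eq_one_of_mem (L_nodup h) (mem_L h a)] at this
      simpa using this
    rw [h7]; simp
  · rw [List.filter_eq_nil_iff.2]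
    · rfl
    · intro i _
      simp only [decide_eq_true_eq, not_and, not_lt]
      intro h4
      by_cases h5 : j = a ∧ i = b
      · obtain ⟨rfl, rfl⟩ := h5
        exact absurd h4 (not_lt.2 h1.le)
      · exact ((h3 j i (by tauto) (by tauto)).1 h4).le

theorem KL_same {h h' hBB : Fin 4 → ℝ} (hs : Same h' hBB) (j : Fin 4) :
    phi h h' (Wd h' hBB j) * Wd h h' j = Wd h hBB j := by
  rw [Wd_same hs, map_one, one_mul]
  unfold Wd
  congr 2
  apply List.filter_congr
  intro i _
  rw [decide_eq_decide, hs i j]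

theorem KL_flip {h h' hBB : Fin 4 → ℝ} {a b : Fin 4} (hi : Function.Injective h)
    (hs : Flip h' hBB a b) (hab : h b < h a) (j : Fin 4) :
    phi h h' (Wd h' hBB j) * Wd h h' j = Wd h hBB j := by
  rw [Wd_flip hs]
  obtain ⟨h1, h2, h3⟩ := hs
  have hne : a ≠ b := by rintro rfl; exact lt_irrefl _ h1
  split_ifs with hj
  · subst hj
    rw [phi_y]
    obtain ⟨l1, l2, hl⟩ := List.append_of_mem (mem_L h a)
    have hp := L_pairwise hi
    rw [hl, List.pairwise_append, List.pairwise_cons] at hp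
    obtain ⟨-, ⟨p2, -⟩, p1⟩ := hp
    have q1 : ∀ i ∈ l1, h a < h i := fun i hi => p1 i hi a (by simp)
    unfold Wd
    rw [hl]
    simp only [List.filter_append, List.filter_cons, lt_irrefl, false_and, decide_false,
      hab, true_and, h2, decide_true, if_true, not_lt.2 h1.le, List.map_append, List.prod_append,
      List.map_cons, List.prod_cons]
    have r1 : l1.filter (fun i => decide (h j < h i ∧ h' i < h' j)) =
        l1.filter (fun i => decide (h a < h i ∧ h' i < h' a)) := by
      apply List.filter_congr
      intro i hi'
      have hai := q1 i hi'
      have hia : i ≠ a := by rintro rfl; exact lt_irrefl _ hai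
      have hib : i ≠ j := by rintro rfl; exact lt_asymm hai hab
      rw [decide_eq_decide]
      simp only [hai, hab.trans hai, true_and]
      constructor
      · intro h4; exact h4.trans h1
      · intro h4
        have h5 := (h3 i a (by tauto) (by tauto)).1 h4
        exact (h3 i j (by tauto) (by tauto)).2 (h5.trans h2)
    have r2 : l1.filter (fun i => decide (h j < h i ∧ hBB i < hBB j)) =
        l1.filter (fun i => decide (h j < h i ∧ h' i < h' j)) := by
      apply List.filter_congr
      intro i hi'
      have hai := q1 i hi'
      have hia : i ≠ a := by rintro rfl; exact lt_irrefl _ hai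
      have hib : i ≠ j := by rintro rfl; exact lt_asymm hai hab
      rw [decide_eq_decide, h3 i j (by tauto) (by tauto)]
    have r3 : l2.filter (fun i => decide (h a < h i ∧ h' i < h' a)) = [] := by
      rw [List.filter_eq_nil_iff]
      intro i hi'
      have := p2 i hi'
      simp [not_lt.2 this.le]
    have r4 : l2.filter (fun i => decide (h j < h i ∧ hBB i < hBB j)) =
        l2.filter (fun i => decide (h j < h i ∧ h' i < h' j)) := by
      apply List.filter_congr
      intro i hi'
      have hai := p2 i hi'
      have hia : i ≠ a := by rintro rfl; exact lt_irrefl _ hai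
      rw [decide_eq_decide]
      by_cases hib : i = j
      · subst hib; simp
      · rw [h3 i j (by tauto) (by tauto)]
    rw [r2, r1, r3, r4]
    simp [mul_assoc]
  · rw [map_one, one_mul]
    unfold Wd
    congr 2
    apply List.filter_congr
    intro i _
    rw [decide_eq_decide]
    by_cases h5 : j = a ∧ i = b
    · obtain ⟨rfl, rfl⟩ := h5
      simp [not_lt.2 hab.le]
    · rw [h3 i j (by tauto) (by tauto)]

/-- Admissible step. -/
def Step (h h' hBB : Fin 4 → ℝ) : Prop :=
  Same h' hBB ∨ ∃ a b, Flip h' hBB a b ∧ h b < h a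

theorem Mh_comp {h h' hBB : Fin 4 → ℝ} (hi : Function.Injective h) (hs : Step h h' hBB) (f : F) :
    Mh h h' (Mh h' hBB f) = Mh h hBB f := by
  have KL : ∀ j, phi h h' (Wd h' hBB j) * Wd h h' j = Wd h hBB j := by
    intro j
    rcases hs with hs | ⟨a, b, hs, hab⟩
    · exact KL_same hs j
    · exact KL_flip hi hs hab j
  unfold Mh
  rw [map_mul, mul_assoc, KL]
  congr 1
  have : (phi h h').comp (phi h' hBB) = phi h hBB := by
    apply FreeGroup.ext_hom
    intro i
    rw [MonoidHom.comp_apply, ← y_succ, phi_y, phi_y, map_mul, map_mul, map_inv, phi_y, ← KL]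
    group
  exact DFunLike.congr_fun this f

theorem Mh_self (h : Fin 4 → ℝ) (f : F) : Mh h h f = f := by
  have hs : Same h h := fun i j => Iff.rfl
  unfold Mh
  rw [Wd_same hs, mul_one]
  have : phi h h = MonoidHom.id F := by
    apply FreeGroup.ext_hom
    intro i
    rw [← y_succ, phi_y, Wd_same hs]; simp
  rw [this]; rfl

theorem phi_same {h h' : Fin 4 → ℝ} (hs : Same h h') : phi h h' = MonoidHom.id F := by
  apply FreeGroup.ext_hom
  intro i
  rw [← y_succ, phi_y, Wd_same hs]; simp

theorem Mh_same {h h' : Fin 4 → ℝ} (hs : Same h h') (f : F) : Mh h h' f = f := by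
  unfold Mh
  rw [Wd_same hs, mul_one, phi_same hs]; rfl

theorem Mh_bij {h h' : Fin 4 → ℝ} (hs : Same h h' ∨ ∃ a b, Flip h h' a b) :
    Function.Bijective (Mh h h') := by
  rcases hs with hs | ⟨a, b, hs⟩
  · have : Mh h h' = id := funext fun f => Mh_same hs f
    rw [this]; exact Function.bijective_id
  · have hne : a ≠ b := by rintro rfl; exact lt_irrefl _ hs.1
    let psi : F →* F := FreeGroup.lift
      (fun i => if i.succ = b then (y a)⁻¹ * FreeGroup.of i * y a else FreeGroup.of i)
    have psi_y : ∀ j, psi (y j) = if j = b then (y a)⁻¹ * y j * y a else y j := by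
      intro j
      refine Fin.cases ?_ (fun i => ?_) j
      · simp [y_zero]
      · simp [y_succ, psi]
    have phi_y' : ∀ j, phi h h' (y j) = if j = b then y a * y j * (y a)⁻¹ else y j := by
      intro j
      rw [phi_y, Wd_flip hs]
      split_ifs <;> simp
    have c1 : ∀ f, psi (phi h h' f) = f := by
      intro f
      have : psi.comp (phi h h') = MonoidHom.id F := by
        apply FreeGroup.ext_hom
        intro i
        rw [MonoidHom.comp_apply, ← y_succ, phi_y']
        split_ifs with h5
        · rw [map_mul, map_mul, map_inv, psi_y a, psi_y, if_neg hne, if_pos h5]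
          simp only [MonoidHom.id_apply]; group
        · rw [psi_y, if_neg h5]; rfl
      exact DFunLike.congr_fun this f
    have c2 : ∀ f, phi h h' (psi f) = f := by
      intro f
      have : (phi h h').comp psi = MonoidHom.id F := by
        apply FreeGroup.ext_hom
        intro i
        rw [MonoidHom.comp_apply, ← y_succ, psi_y]
        split_ifs with h5
        · rw [map_mul, map_mul, map_inv, phi_y' a, phi_y', if_neg hne, if_pos h5]
          simp only [MonoidHom.id_apply]; group
        · rw [phi_y', if_neg h5]; rfl
      exact DFunLike.congr_fun this f
    refine Function.bijective_iff_has_inverse.2 ⟨fun f => psi (f * (Wd h h' 0)⁻¹), ?_, ?_⟩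
    · intro f; simp [Mh, c1]
    · intro f; simp [Mh, c2, mul_assoc]
end TriArt
end

section
namespace TriArt
variable (M : CoxeterMatrix (Fin 3)) (hM : ∀ i j, i ≠ j → 2 ≤ M i j)

/-- Sum of the coordinates. -/
noncomputable def sm : V →ₗ[ℝ] ℝ := ∑ j, LinearMap.proj j

theorem sm_apply (v : V) : sm v = ∑ j, v j := by simp [sm]

theorem sm_e (i : Fin 3) : sm (e i) = 1 := by simp [sm_apply, e]

theorem sm_pos {v : V} (h : 0 ≤ v) (h0 : v ≠ 0) : 0 < sm v := by
  rw [sm_apply]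
  obtain ⟨i, hi⟩ := Function.ne_iff.1 h0
  exact Finset.sum_pos' (fun i _ => h i) ⟨i, Finset.mem_univ _, lt_of_le_of_ne (h i) (Ne.symm hi)⟩

theorem sm_neg {v : V} (h : v ≤ 0) (h0 : v ≠ 0) : sm v < 0 := by
  have := sm_pos (neg_nonneg.2 h) (neg_ne_zero.2 h0)
  rw [map_neg] at this; linarith

theorem nonneg_of_sm {v : V} (h : Good M hM v) (h0 : 0 < sm v) : 0 ≤ v := by
  rcases h.sign with h1 | h1
  · exact h1
  · have := sm_neg h1 h.1; linarith

theorem nonpos_of_sm {v : V} (h : Good M hM v) (h0 : sm v < 0) : v ≤ 0 := by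
  rcases h.sign with h1 | h1
  · have := sm_pos h1 h.1; linarith
  · exact h1

/-- Heights of strands. -/
noncomputable def ht (ω : Fin 4 → V) (i : Fin 4) : ℝ := sm (ω i)

/-- Validity of configurations. -/
def Valid (ω : Fin 4 → V) : Prop :=
  (∀ i j, i ≠ j → Good M hM (ω i - ω j)) ∧
  ∀ c : Fin 4 → ℝ, ∑ i, c i = 0 → ∑ i, c i • ω i = 0 → c = 0

/-- Configurations. -/
abbrev Om := {ω : Fin 4 → V // Valid M hM ω}

variable {M hM}

theorem Valid.ht_inj {ω : Fin 4 → V} (h : Valid M hM ω) : Function.Injective (ht ω) := by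
  intro i j hij
  by_contra hne
  have hg := h.1 i j hne
  have : sm (ω i - ω j) = 0 := by rw [map_sub]; exact sub_eq_zero.2 hij
  rcases hg.sign with h1 | h1
  · have := sm_pos h1 hg.1; linarith
  · have := sm_neg h1 hg.1; linarith

theorem Valid.S {ω : Fin 4 → V} (h : Valid M hM ω) (s : Fin 3) :
    Valid M hM (fun i => S M s (ω i)) := by
  refine ⟨fun i j hij => ?_, fun c hc hs => h.2 c hc ?_⟩
  · simp only [← map_sub]; exact (h.1 i j hij).S s
  · simp only [← map_smul, ← map_sum] at hs
    have := congrArg (TriArt.S M s) hs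
    rwa [S_S, map_zero] at this

theorem Valid.flip {ω : Fin 4 → V} (h : Valid M hM ω) {s : Fin 3} {a b : Fin 4}
    (h1 : ht ω b < ht ω a) (h2 : ht (fun i => TriArt.S M s (ω i)) a < ht (fun i => TriArt.S M s (ω i)) b) :
    ∃ p : ℝ, 0 < p ∧ ω a - ω b = p • e s := by
  have hne : a ≠ b := by rintro rfl; exact lt_irrefl _ h1
  have hg := h.1 a b hne
  have hg' := hg.S s
  have k1 : 0 ≤ ω a - ω b := nonneg_of_sm M hM hg (by rw [map_sub]; exact sub_pos.2 h1)
  have k2 : TriArt.S M s (ω a - ω b) ≤ 0 :=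
    nonpos_of_sm M hM hg' (by rw [map_sub, map_sub]; exact sub_neg.2 h2)
  have k3 := flip_simple k1 k2
  refine ⟨_, ?_, k3⟩
  refine lt_of_le_of_ne (k1 s) (fun h0 => hg.1 ?_)
  rw [k3, ← h0]; simp

theorem Valid.flip_unique {ω : Fin 4 → V} (h : Valid M hM ω) {s : Fin 3} {a b i j : Fin 4} {p q : ℝ}
    (hp : 0 < p) (hq : 0 < q) (hab : a ≠ b)
    (h1 : ω a - ω b = p • e s) (h2 : ω i - ω j = q • e s) : i = a ∧ j = b := by
  have key := h.2 (fun k => q * ((if k = a then 1 else 0) - (if k = b then 1 else 0)) -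
    p * ((if k = i then 1 else 0) - (if k = j then 1 else 0))) (by
      rw [Finset.sum_sub_distrib, ← Finset.mul_sum, ← Finset.mul_sum, Finset.sum_sub_distrib,
        Finset.sum_sub_distrib]
      simp) (by
      simp only [sub_smul, mul_smul, Finset.sum_sub_distrib, ← Finset.smul_sum, ite_smul, one_smul,
        zero_smul, Finset.sum_ite_eq', Finset.mem_univ, if_true]
      rw [h1, h2, smul_smul, smul_smul, mul_comm q p, sub_self])
  have ka := congrFun key a
  have kb := congrFun key b
  simp only [if_true, hab, hab.symm, if_false, Pi.zero_apply] at ka kb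
  constructor
  · by_contra hia
    simp only [Ne.symm (a := i) (b := a) hia, if_false] at ka
    split_ifs at ka <;> nlinarith
  · by_contra hjb
    simp only [Ne.symm (a := j) (b := b) hjb, if_false] at kb
    split_ifs at kb <;> nlinarith

theorem Valid.step {ω : Fin 4 → V} (h : Valid M hM ω) (s : Fin 3) :
    Same (ht ω) (ht (fun i => TriArt.S M s (ω i))) ∨
    ∃ a b, Flip (ht ω) (ht (fun i => TriArt.S M s (ω i))) a b ∧ ∃ p : ℝ, 0 < p ∧ ω a - ω b = p • e s := by
  set h' := ht (fun i => TriArt.S M s (ω i)) with hh'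
  have hi := h.ht_inj
  have hi' : Function.Injective h' := (h.S s).ht_inj
  by_cases hf : ∃ a b, ht ω b < ht ω a ∧ h' a < h' b
  · right
    obtain ⟨a, b, h1, h2⟩ := hf
    have hne : a ≠ b := by rintro rfl; exact lt_irrefl _ h1
    obtain ⟨p, hp, hpe⟩ := h.flip h1 h2
    refine ⟨a, b, ⟨h1, h2, ?_⟩, p, hp, hpe⟩
    intro i j n1 n2
    by_cases hij : i = j
    · subst hij; simp
    constructor
    · intro h3
      by_contra h4
      have h5 : h' j < h' i := lt_of_le_of_ne (not_lt.1 h4) (hi'.ne (Ne.symm hij))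
      obtain ⟨q, hq, hqe⟩ := h.flip h3 h5
      have := h.flip_unique hp hq hne hpe hqe
      tauto
    · intro h3
      by_contra h4
      have h5 : ht ω j < ht ω i := lt_of_le_of_ne (not_lt.1 h4) (hi.ne (Ne.symm hij))
      obtain ⟨q, hq, hqe⟩ := h.flip h5 h3
      have := h.flip_unique hp hq hne hpe hqe
      tauto
  · left
    push Not at hf
    intro i j
    by_cases hij : i = j
    · subst hij; simp
    constructor
    · intro h3; exact lt_of_le_of_ne (hf _ _ h3) (hi'.ne hij)
    · intro h3
      by_contra h4
      have h5 : ht ω j < ht ω i := lt_of_le_of_ne (not_lt.1 h4) (hi.ne (Ne.symm hij))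
      exact absurd h3 (not_lt.2 (hf _ _ h5))

theorem Valid.step' {ω : Fin 4 → V} (h : Valid M hM ω) (s : Fin 3) :
    Same (ht (fun i => TriArt.S M s (ω i))) (ht ω) ∨
    ∃ a b, Flip (ht (fun i => TriArt.S M s (ω i))) (ht ω) a b ∧
      ∃ p : ℝ, 0 < p ∧ TriArt.S M s (ω a) - TriArt.S M s (ω b) = p • e s := by
  have := (h.S s).step s
  simpa only [S_S] using this

variable (M hM)
/-- Reflection acting on configurations. -/
noncomputable def SOm (s : Fin 3) (ω : Om M hM) : Om M hM := ⟨fun i => S M s (ω.1 i), ω.2.S s⟩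

theorem SOm_SOm (s : Fin 3) (ω : Om M hM) : SOm M hM s (SOm M hM s ω) = ω := by
  apply Subtype.ext; funext i; exact S_S M s _

/-- The elementary transformation. -/
noncomputable def T0 (s : Fin 3) (x : Om M hM × F) : Om M hM × F :=
  (SOm M hM s x.1, Mh (ht (SOm M hM s x.1).1) (ht x.1.1) x.2)

theorem T0_bij (s : Fin 3) : Function.Bijective (T0 M hM s) := by
  have hb : ∀ ω : Om M hM, Function.Bijective (Mh (ht (SOm M hM s ω).1) (ht ω.1)) := by
    intro ω
    apply Mh_bij
    rcases ω.2.step' s with h | ⟨a, b, h, -⟩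
    · exact Or.inl h
    · exact Or.inr ⟨a, b, h⟩
  constructor
  · rintro ⟨ω, f⟩ ⟨ω', f'⟩ h
    unfold T0 at h
    rw [Prod.mk.injEq] at h
    obtain ⟨h1, h2⟩ := h
    have h3 : ω = ω' := by
      have := congrArg (SOm M hM s) h1
      rwa [SOm_SOm, SOm_SOm] at this
    subst h3
    exact Prod.ext rfl ((hb ω).1 h2)
  · rintro ⟨ω, f⟩
    obtain ⟨f', hf'⟩ := (hb (SOm M hM s ω)).2 f
    refine ⟨(SOm M hM s ω, f'), ?_⟩
    unfold T0
    apply Prod.ext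
    · exact SOm_SOm M hM s ω
    · exact hf'

/-- The elementary permutation. -/
noncomputable def T (s : Fin 3) : Equiv.Perm (Om M hM × F) := Equiv.ofBijective _ (T0_bij M hM s)

theorem T_apply (s : Fin 3) (x : Om M hM × F) :
    T M hM s x = (SOm M hM s x.1, Mh (ht (SOm M hM s x.1).1) (ht x.1.1) x.2) := rfl

theorem good_alt {i j : Fin 3} (n : ℕ) {v : V} (hv : Good M hM v) :
    Good M hM (altProd (S M i) (S M j) n v) := by
  induction n generalizing i j with
  | zero => simpa [altProd_zero] using hv
  | succ n ih => rw [altProd_succ, Module.End.mul_apply]; exact ih.S _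

theorem T_alt {i j : Fin 3} (h : i ≠ j) (n : ℕ) (hn : n ≤ M i j) (x : Om M hM × F) :
    (altProd (T M hM i) (T M hM j) n x).1.1 = (fun t => altProd (S M i) (S M j) n (x.1.1 t)) ∧
    (altProd (T M hM i) (T M hM j) n x).2 =
      Mh (ht (fun t => altProd (S M i) (S M j) n (x.1.1 t))) (ht x.1.1) x.2 := by
  induction n generalizing x with
  | zero => simp [altProd_zero, Mh_self]
  | succ n ih =>
    set s := if n % 2 = 0 then i else j with hs
    have e1 : altProd (T M hM i) (T M hM j) (n + 1) = altProd (T M hM i) (T M hM j) n * T M hM s := by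
      rw [altProd_succ', hs]; split_ifs <;> rfl
    have e2 : altProd (S M i) (S M j) (n + 1) = altProd (S M i) (S M j) n * S M s := by
      rw [altProd_succ', hs]; split_ifs <;> rfl
    have e3 := alt_formula M hM h n
    have e4 : (if n % 2 = 0 then e i else e j) = e s := by rw [hs]; split_ifs <;> rfl
    rw [e4] at e3
    obtain ⟨i1, i2⟩ := ih (by omega) (T M hM s x)
    rw [e1, e2, Equiv.Perm.mul_apply]
    have e5 : (fun t => altProd (S M i) (S M j) n ((T M hM s x).1.1 t)) =
      (fun t => (altProd (S M i) (S M j) n * S M s) (x.1.1 t)) := rfl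
    have hval : Valid M hM (fun t => (altProd (S M i) (S M j) n * S M s) (x.1.1 t)) := by
      rw [← e5, ← i1]; exact (altProd (T M hM i) (T M hM j) n (T M hM s x)).1.2
    refine ⟨i1, ?_⟩
    rw [i2, e5]
    refine Mh_comp hval.ht_inj ?_ x.2
    rcases x.1.2.step' s with h' | ⟨a, b, h', p, hp, hpe⟩
    · exact Or.inl h'
    · refine Or.inr ⟨a, b, h', ?_⟩
      have e6 : sm (altProd (S M i) (S M j) n (S M s (x.1.1 a) - S M s (x.1.1 b))) > 0 := by
        rw [hpe, map_smul, map_smul, smul_eq_mul]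
        apply mul_pos hp
        apply sm_pos _ (good_alt M hM n (good_e s)).1
        rw [e3]
        exact add_nonneg (smul_nonneg (U_nonneg (hM i j h) hn) (e_nonneg _))
          (smul_nonneg (U_nonneg (hM i j h) (by omega)) (e_nonneg _))
      rw [map_sub, map_sub] at e6
      exact sub_pos.1 e6

theorem T_braid {i j : Fin 3} (h : i ≠ j) :
    altProd (T M hM i) (T M hM j) (M i j) = altProd (T M hM j) (T M hM i) (M i j) := by
  apply Equiv.ext
  intro x
  obtain ⟨h1, h2⟩ := T_alt M hM h (M i j) le_rfl x
  obtain ⟨h3, h4⟩ := T_alt M hM h.symm (M i j) (by rw [M.symmetric]) x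
  rw [← S_braid M hM h] at h3 h4
  exact Prod.ext (Subtype.ext (h1.trans h3.symm)) (h2.trans h4.symm)

/-- The action of the Artin group. -/
theorem exists_action (ℓ : Fin 3 → Fin 3 → ℕ) (hℓ : ∀ i j, i ≠ j → ℓ i j = M i j) :
    ∃ Ψ : ArtinGroup (⊤ : SimpleGraph (Fin 3)) ℓ →* Equiv.Perm (Om M hM × F),
      ∀ i, Ψ (PresentedGroup.of i) = T M hM i := by
  have hr : ∀ r ∈ artinRels (⊤ : SimpleGraph (Fin 3)) ℓ, FreeGroup.lift (T M hM) r = 1 := by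
    rintro r ⟨u, v, huv, rfl⟩
    have hne : u ≠ v := huv
    rw [map_mul, map_inv, map_altProd, map_altProd, FreeGroup.lift_apply_of, FreeGroup.lift_apply_of,
      hℓ u v hne, T_braid M hM hne, mul_inv_cancel]
  exact ⟨PresentedGroup.toGroup hr, fun i => PresentedGroup.toGroup.of hr⟩

end TriArt
end

section
namespace TriArt

theorem Wd_congr {h h' k k' : Fin 4 → ℝ} (hi : Function.Injective h)
    (h1 : Same k h) (h2 : Same k' h') (j : Fin 4) : Wd h h' j = Wd k k' j := by
  have hk : Function.Injective k := by
    intro a b hab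
    by_contra hne
    rcases lt_or_gt_of_ne (hi.ne hne) with h3 | h3
    · have := (h1 _ _).2 h3; exact this.ne hab
    · have := (h1 _ _).2 h3; exact this.ne hab.symm
  have : L h = L k := L_eq (L_perm k) ((L_pairwise hk).imp (fun {a b} h3 => (h1 _ _).1 h3)) hi
  unfold Wd
  rw [this]
  congr 2
  apply List.filter_congr
  intro i _
  rw [decide_eq_decide, h1, h2]

theorem Mh_congr {h h' k k' : Fin 4 → ℝ} (hi : Function.Injective h)
    (h1 : Same k h) (h2 : Same k' h') (f : F) : Mh h h' f = Mh k k' f := by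
  have : phi h h' = phi k k' := by
    unfold phi; simp only [Wd_congr hi h1 h2]
  unfold Mh
  rw [this, Wd_congr hi h1 h2]

theorem same_of {k h : Fin 4 → ℝ} (hk : Function.Injective k) (H : ∀ i j, k i < k j → h i < h j) :
    Same k h := by
  intro i j
  refine ⟨H i j, fun h1 => ?_⟩
  by_contra h2
  rcases (not_lt.1 h2).lt_or_eq with h3 | h3
  · exact lt_asymm h1 (H _ _ h3)
  · rw [hk h3] at h1; exact lt_irrefl _ h1

theorem forall4 {P : Fin 4 → Prop} (h0 : P 0) (h1 : P 1) (h2 : P 2) (h3 : P 3) (i : Fin 4) : P i := by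
  fin_cases i
  · exact h0
  · exact h1
  · exact h2
  · exact h3

theorem v0 {α : Type*} (a b c d : α) : ![a, b, c, d] (0 : Fin 4) = a := rfl
theorem v1 {α : Type*} (a b c d : α) : ![a, b, c, d] (1 : Fin 4) = b := rfl
theorem v2 {α : Type*} (a b c d : α) : ![a, b, c, d] (2 : Fin 4) = c := rfl
theorem v3 {α : Type*} (a b c d : α) : ![a, b, c, d] (3 : Fin 4) = d := rfl

/-- Model heights. -/
noncomputable def k0 : Fin 4 → ℝ := ![3, 2, 1, 0]
/-- Model heights. -/
noncomputable def kb : Fin 4 → ℝ := ![2, 3, 1, 0]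
/-- Model heights. -/
noncomputable def kc : Fin 4 → ℝ := ![3, 1, 2, 0]
/-- Model heights. -/
noncomputable def kbc : Fin 4 → ℝ := ![1, 2, 3, 0]
/-- Model heights. -/
noncomputable def kac : Fin 4 → ℝ := ![3, 0, 1, 2]

theorem k0_inj : Function.Injective k0 := by
  intro i j; fin_cases i <;> fin_cases j <;> norm_num [k0]
theorem kb_inj : Function.Injective kb := by
  intro i j; fin_cases i <;> fin_cases j <;> norm_num [kb]
theorem kc_inj : Function.Injective kc := by
  intro i j; fin_cases i <;> fin_cases j <;> norm_num [kc]
theorem kbc_inj : Function.Injective kbc := by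
  intro i j; fin_cases i <;> fin_cases j <;> norm_num [kbc]
theorem kac_inj : Function.Injective kac := by
  intro i j; fin_cases i <;> fin_cases j <;> norm_num [kac]

theorem same_k0 {h : Fin 4 → ℝ} (h1 : h 1 < h 0) (h2 : h 2 < h 1) (h3 : h 3 < h 2) : Same k0 h := by
  apply same_of k0_inj
  refine forall4 ?_ ?_ ?_ ?_ <;> refine forall4 ?_ ?_ ?_ ?_ <;> simp only [k0, v0, v1, v2, v3] <;>
    norm_num <;> linarith
theorem same_kb {h : Fin 4 → ℝ} (h1 : h 0 < h 1) (h2 : h 2 < h 0) (h3 : h 3 < h 2) : Same kb h := by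
  apply same_of kb_inj
  refine forall4 ?_ ?_ ?_ ?_ <;> refine forall4 ?_ ?_ ?_ ?_ <;> simp only [kb, v0, v1, v2, v3] <;>
    norm_num <;> linarith
theorem same_kc {h : Fin 4 → ℝ} (h1 : h 2 < h 0) (h2 : h 1 < h 2) (h3 : h 3 < h 1) : Same kc h := by
  apply same_of kc_inj
  refine forall4 ?_ ?_ ?_ ?_ <;> refine forall4 ?_ ?_ ?_ ?_ <;> simp only [kc, v0, v1, v2, v3] <;>
    norm_num <;> linarith
theorem same_kbc {h : Fin 4 → ℝ} (h1 : h 1 < h 2) (h2 : h 0 < h 1) (h3 : h 3 < h 0) : Same kbc h := by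
  apply same_of kbc_inj
  refine forall4 ?_ ?_ ?_ ?_ <;> refine forall4 ?_ ?_ ?_ ?_ <;> simp only [kbc, v0, v1, v2, v3] <;>
    norm_num <;> linarith
theorem same_kac {h : Fin 4 → ℝ} (h1 : h 3 < h 0) (h2 : h 2 < h 3) (h3 : h 1 < h 2) : Same kac h := by
  apply same_of kac_inj
  refine forall4 ?_ ?_ ?_ ?_ <;> refine forall4 ?_ ?_ ?_ ?_ <;> simp only [kac, v0, v1, v2, v3] <;>
    norm_num <;> linarith

theorem L_k0 : L k0 = [0, 1, 2, 3] := L_eq (by decide) (by simp [k0]; norm_num) k0_inj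
theorem L_kb : L kb = [1, 0, 2, 3] := L_eq (by decide) (by simp [kb]; norm_num) kb_inj
theorem L_kc : L kc = [0, 2, 1, 3] := L_eq (by decide) (by simp [kc]; norm_num) kc_inj
theorem L_kbc : L kbc = [2, 1, 0, 3] := L_eq (by decide) (by simp [kbc]; norm_num) kbc_inj
theorem L_kac : L kac = [0, 3, 2, 1] := L_eq (by decide) (by simp [kac]; norm_num) kac_inj

theorem Wd_b0 (j : Fin 4) : Wd kb k0 j = ![y 1, 1, 1, 1] j := by
  revert j; unfold Wd; rw [L_kb]
  refine forall4 ?_ ?_ ?_ ?_ <;>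
    norm_num [kb, k0, List.filter_cons, v0, v1, v2, v3]
theorem Wd_0b (j : Fin 4) : Wd k0 kb j = ![1, y 0, 1, 1] j := by
  revert j; unfold Wd; rw [L_k0]
  refine forall4 ?_ ?_ ?_ ?_ <;>
    norm_num [kb, k0, List.filter_cons, v0, v1, v2, v3]
theorem Wd_c0 (j : Fin 4) : Wd kc k0 j = ![1, y 2, 1, 1] j := by
  revert j; unfold Wd; rw [L_kc]
  refine forall4 ?_ ?_ ?_ ?_ <;>
    norm_num [kc, k0, List.filter_cons, v0, v1, v2, v3]
theorem Wd_0c (j : Fin 4) : Wd k0 kc j = ![1, 1, y 1, 1] j := by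
  revert j; unfold Wd; rw [L_k0]
  refine forall4 ?_ ?_ ?_ ?_ <;>
    norm_num [kc, k0, List.filter_cons, v0, v1, v2, v3]
theorem Wd_bc0 (j : Fin 4) : Wd kbc k0 j = ![y 2 * y 1, y 2, 1, 1] j := by
  revert j; unfold Wd; rw [L_kbc]
  refine forall4 ?_ ?_ ?_ ?_ <;>
    norm_num [kbc, k0, List.filter_cons, v0, v1, v2, v3]
theorem Wd_0bc (j : Fin 4) : Wd k0 kbc j = ![1, y 0, y 0 * y 1, 1] j := by
  revert j; unfold Wd; rw [L_k0]
  refine forall4 ?_ ?_ ?_ ?_ <;>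
    norm_num [kbc, k0, List.filter_cons, v0, v1, v2, v3]
theorem Wd_ac0 (j : Fin 4) : Wd kac k0 j = ![1, y 3 * y 2, y 3, 1] j := by
  revert j; unfold Wd; rw [L_kac]
  refine forall4 ?_ ?_ ?_ ?_ <;>
    norm_num [kac, k0, List.filter_cons, v0, v1, v2, v3]
theorem Wd_0ac (j : Fin 4) : Wd k0 kac j = ![1, 1, y 1, y 1 * y 2] j := by
  revert j; unfold Wd; rw [L_k0]
  refine forall4 ?_ ?_ ?_ ?_ <;>
    norm_num [kac, k0, List.filter_cons, v0, v1, v2, v3]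

theorem y_1 : y 1 = FreeGroup.of 0 := rfl
theorem y_2 : y 2 = FreeGroup.of 1 := rfl
theorem y_3 : y 3 = FreeGroup.of 2 := rfl

/-- Automorphism induced by `c²`. -/
def alpha : F →* F := FreeGroup.lift ![y 1 * y 2 * y 1 * (y 1 * y 2)⁻¹, y 1 * y 2 * y 2 * (y 1 * y 2)⁻¹, y 3]

theorem comp_eq {φ ψ χ : F →* F} (h : ∀ i : Fin 3, φ (ψ (y i.succ)) = χ (y i.succ)) (f : F) :
    φ (ψ f) = χ f := by
  have : φ.comp ψ = χ := FreeGroup.ext_hom _ _ h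
  exact DFunLike.congr_fun this f

theorem alpha_y1 : alpha (y 1) = y 1 * y 2 * y 1 * (y 1 * y 2)⁻¹ := by simp [alpha, y_1]
theorem alpha_y2 : alpha (y 2) = y 1 * y 2 * y 2 * (y 1 * y 2)⁻¹ := by simp [alpha, y_2]
theorem alpha_y3 : alpha (y 3) = y 3 := by simp [alpha, y_3]

theorem forall_y {P : F → Prop} (h1 : P (y 1)) (h2 : P (y 2)) (h3 : P (y 3)) (i : Fin 3) :
    P (y i.succ) := by
  fin_cases i
  · exact h1
  · exact h2
  · exact h3

theorem Mh_b (f : F) : Mh k0 kb (Mh kb k0 f) = f * y 1 := by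
  unfold Mh
  rw [map_mul, Wd_b0, Wd_0b]
  have := comp_eq (φ := phi k0 kb) (ψ := phi kb k0) (χ := MonoidHom.id F)
    (forall_y (P := fun u => phi k0 kb (phi kb k0 u) = MonoidHom.id F u)
      (by simp [phi_y, Wd_b0, Wd_0b, y_zero]) (by simp [phi_y, Wd_b0, Wd_0b, y_zero]) (by simp [phi_y, Wd_b0, Wd_0b, y_zero])) f
  rw [this]
  simp [phi_y, Wd_0b, y_zero]

theorem Mh_c (f : F) : Mh k0 kc (Mh kc k0 f) = alpha f := by
  unfold Mh
  rw [map_mul, Wd_c0, Wd_0c]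
  have := comp_eq (φ := phi k0 kc) (ψ := phi kc k0) (χ := alpha)
    (forall_y (P := fun u => phi k0 kc (phi kc k0 u) = alpha u)
      (by simp [phi_y, Wd_c0, Wd_0c, alpha_y1, mul_assoc]) (by simp [phi_y, Wd_c0, Wd_0c, alpha_y2, mul_assoc])
      (by simp [phi_y, Wd_c0, Wd_0c, alpha_y3])) f
  rw [this]
  simp

theorem Mh_bc (f : F) : Mh k0 kbc (Mh kbc k0 f) = alpha f * (y 1 * y 2) := by
  unfold Mh
  rw [map_mul, Wd_bc0, Wd_0bc]
  have := comp_eq (φ := phi k0 kbc) (ψ := phi kbc k0) (χ := alpha)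
    (forall_y (P := fun u => phi k0 kbc (phi kbc k0 u) = alpha u)
      (by simp [phi_y, Wd_bc0, Wd_0bc, alpha_y1, mul_assoc, y_zero])
      (by simp [phi_y, Wd_bc0, Wd_0bc, alpha_y2, mul_assoc, y_zero])
      (by simp [phi_y, Wd_bc0, Wd_0bc, alpha_y3])) f
  rw [this]
  simp [phi_y, Wd_0bc, y_zero]

theorem Mh_ac (f : F) : Mh k0 kac (Mh kac k0 f) = (y 1 * y 2 * y 3) * f * (y 1 * y 2 * y 3)⁻¹ := by
  unfold Mh
  rw [map_mul, Wd_ac0, Wd_0ac]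
  have := comp_eq (φ := phi k0 kac) (ψ := phi kac k0) (χ := (MulAut.conj (y 1 * y 2 * y 3)).toMonoidHom)
    (forall_y (P := fun u => phi k0 kac (phi kac k0 u) = (MulAut.conj (y 1 * y 2 * y 3)).toMonoidHom u)
      (by simp [phi_y, Wd_ac0, Wd_0ac, mul_assoc])
      (by simp [phi_y, Wd_ac0, Wd_0ac, mul_assoc])
      (by simp [phi_y, Wd_ac0, Wd_0ac, mul_assoc])) f
  rw [this]
  simp [mul_assoc]

end TriArt
end

section
namespace TriArt
variable (M : CoxeterMatrix (Fin 3)) (hM : ∀ i j, i ≠ j → 2 ≤ M i j)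

theorem alt_sq (hM : ∀ i j, i ≠ j → 2 ≤ M i j) {i j : Fin 3} (h : i ≠ j) (v : V) :
    altProd (S M i) (S M j) (M i j) (altProd (S M i) (S M j) (M i j) v) = v := by
  have h1 := S_liftable M hM i j
  rw [← altProd_double, two_mul, altProd_add, ← S_braid M hM h, ite_self] at h1
  have := LinearMap.congr_fun h1 v
  simpa using this

theorem S_coord {i k : Fin 3} (h : k ≠ i) (v : V) : S M i v k = v k := by
  simp [S_apply, e, h]

theorem alt_coord {i j k : Fin 3} (hi : k ≠ i) (hj : k ≠ j) (n : ℕ) (v : V) :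
    altProd (S M i) (S M j) n v k = v k := by
  induction n generalizing i j with
  | zero => simp [altProd_zero]
  | succ n ih => rw [altProd_succ, Module.End.mul_apply, S_coord M hi, ih hj hi]

variable {M hM}

theorem Good.coord {v : V} (h : Good M hM v) {k : Fin 3} (hk : 0 < v k) : 0 < sm v := by
  rcases h.sign with h1 | h1
  · exact sm_pos h1 h.1
  · exact absurd (h1 k) (not_le.2 hk)

theorem up_S {v : V} (h : Good M hM v) {i k : Fin 3} (hk : 0 < v k) (hi : k ≠ i) : 0 < sm (S M i v) :=
  (h.S i).coord (k := k) (by rwa [S_coord M hi])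

theorem up_alt {v : V} (h : Good M hM v) {i j k : Fin 3} (hk : 0 < v k) (hi : k ≠ i) (hj : k ≠ j)
    (n : ℕ) : 0 < sm (altProd (S M i) (S M j) n v) :=
  (good_alt M hM n h).coord (k := k) (by rwa [alt_coord M hi hj])

theorem down_S {i : Fin 3} {p : ℝ} (hp : 0 < p) : sm (S M i (p • e i)) < 0 := by
  rw [S_apply, map_smul, bil_self, map_add, map_smul, map_smul, sm_e]
  simp; linarith

theorem down_alt (hM : ∀ i j, i ≠ j → 2 ≤ M i j) {i j : Fin 3} (h : i ≠ j) {p q : ℝ} (hpq : 0 < p + q) :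
    sm (altProd (S M i) (S M j) (M i j) (p • e i + q • e j)) < 0 := by
  rw [alt_long M hM h]
  split_ifs <;> simp [sm_e] <;> linarith

theorem T_sq (s : Fin 3) (ω : Om M hM) (f : F) :
    T M hM s (T M hM s (ω, f)) = (ω, Mh (ht ω.1) (ht (fun i => S M s (ω.1 i)))
      (Mh (ht (fun i => S M s (ω.1 i))) (ht ω.1) f)) := by
  rw [T_apply, T_apply]
  apply Prod.ext
  · exact SOm_SOm M hM s ω
  · simp only [SOm_SOm]; rfl

theorem Talt_sq {i j : Fin 3} (h : i ≠ j) (ω : Om M hM) (f : F) :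
    altProd (T M hM i) (T M hM j) (M i j) (altProd (T M hM i) (T M hM j) (M i j) (ω, f)) =
      (ω, Mh (ht ω.1) (ht (fun t => altProd (S M i) (S M j) (M i j) (ω.1 t)))
      (Mh (ht (fun t => altProd (S M i) (S M j) (M i j) (ω.1 t))) (ht ω.1) f)) := by
  obtain ⟨h1, h2⟩ := T_alt M hM h (M i j) le_rfl (ω, f)
  obtain ⟨h3, h4⟩ := T_alt M hM h (M i j) le_rfl (altProd (T M hM i) (T M hM j) (M i j) (ω, f))
  rw [h1] at h3 h4
  simp only [alt_sq M hM h] at h3 h4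
  apply Prod.ext
  · exact Subtype.ext h3
  · rw [h4, h2]

variable (M hM) in
theorem base {β γ p q : ℝ} (hβ : 0 < β) (hγ : 0 < γ) (hp : 0 < p) (hq : 0 ≤ q)
    (g3 : Good M hM (p • e 0 + q • e 2)) (g12 : Good M hM (β • e 1 + γ • e 2))
    (g23 : Good M hM (γ • e 2 + (p • e 0 + q • e 2)))
    (g : Good M hM (β • e 1 + (γ • e 2 + (p • e 0 + q • e 2)))) :
    ∃ ω : Om M hM, ∀ f : F,
      T M hM 1 (T M hM 1 (ω, f)) = (ω, f * y 1) ∧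
      T M hM 2 (T M hM 2 (ω, f)) = (ω, alpha f) ∧
      altProd (T M hM 1) (T M hM 2) (M 1 2) (altProd (T M hM 1) (T M hM 2) (M 1 2) (ω, f)) =
        (ω, alpha f * (y 1 * y 2)) ∧
      altProd (T M hM 0) (T M hM 2) (M 0 2) (altProd (T M hM 0) (T M hM 2) (M 0 2) (ω, f)) =
        (ω, (y 1 * y 2 * y 3) * f * (y 1 * y 2 * y 3)⁻¹) := by
  have g1 : Good M hM (β • e 1) := (good_e 1).smul hβ
  have g2 : Good M hM (γ • e 2) := (good_e 2).smul hγ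
  obtain ⟨z, hz⟩ : ∃ z : Fin 4 → V, z = ![β • e 1 + (γ • e 2 + (p • e 0 + q • e 2)),
    γ • e 2 + (p • e 0 + q • e 2), p • e 0 + q • e 2, 0] := ⟨_, rfl⟩
  have z0 : z 0 = β • e 1 + (γ • e 2 + (p • e 0 + q • e 2)) := by rw [hz, v0]
  have z1 : z 1 = γ • e 2 + (p • e 0 + q • e 2) := by rw [hz, v1]
  have z2 : z 2 = p • e 0 + q • e 2 := by rw [hz, v2]
  have z3 : z 3 = 0 := by rw [hz, v3]
  clear hz
  have d01 : z 0 - z 1 = β • e 1 := by rw [z0, z1]; module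
  have d12 : z 1 - z 2 = γ • e 2 := by rw [z1, z2]; module
  have d23 : z 2 - z 3 = p • e 0 + q • e 2 := by rw [z2, z3]; module
  have d02 : z 0 - z 2 = β • e 1 + γ • e 2 := by rw [z0, z2]; module
  have d13 : z 1 - z 3 = γ • e 2 + (p • e 0 + q • e 2) := by rw [z1, z3]; module
  have d03 : z 0 - z 3 = β • e 1 + (γ • e 2 + (p • e 0 + q • e 2)) := by rw [z0, z3]; module
  rw [← d01] at g1
  rw [← d12] at g2
  rw [← d23] at g3
  rw [← d02] at g12
  rw [← d13] at g23
  rw [← d03] at g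
  have hv : Valid M hM z := by
    constructor
    · refine forall4 ?_ ?_ ?_ ?_ <;> refine forall4 ?_ ?_ ?_ ?_ <;> intro hij <;>
        first
        | exact absurd rfl hij
        | assumption
        | (rw [← neg_sub]; apply Good.neg; assumption)
    · intro c hc hs
      simp only [Fin.sum_univ_four, z0, z1, z2, z3] at hc hs
      have s0 := congrFun hs 0
      have s1 := congrFun hs 1
      have s2 := congrFun hs 2
      simp [e] at s0 s1 s2
      have c0 : c 0 = 0 := by rcases s1 with h | h; exact h; exact absurd h hβ.ne'
      rw [c0] at s0 s2 hc
      have c12 : (c 1 + c 2) * p = 0 := by linarith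
      have c12' : c 1 + c 2 = 0 := (mul_eq_zero.1 c12).resolve_right hp.ne'
      have c1 : c 1 * γ = 0 := by
        have : c 2 = - c 1 := by linarith
        rw [this] at s2; linarith
      have c1' : c 1 = 0 := (mul_eq_zero.1 c1).resolve_right hγ.ne'
      funext i
      revert i
      refine forall4 c0 c1' ?_ ?_
      · simp; linarith
      · simp; linarith
  have b01 : 0 < (z 0 - z 1) 1 := by rw [d01]; simpa [e] using hβ
  have b02 : 0 < (z 0 - z 2) 1 := by rw [d02]; simpa [e] using hβ
  have b03 : 0 < (z 0 - z 3) 1 := by rw [d03]; simpa [e] using hβ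
  have a23 : 0 < (z 2 - z 3) 0 := by rw [d23]; simpa [e] using hp
  have a13 : 0 < (z 1 - z 3) 0 := by rw [d13]; simpa [e] using hp
  have a03 : 0 < (z 0 - z 3) 0 := by rw [d03]; simpa [e] using hp
  have c02 : 0 < (z 0 - z 2) 2 := by rw [d02]; simpa [e] using hγ
  have c12 : 0 < (z 1 - z 2) 2 := by rw [d12]; simpa [e] using hγ
  have up : ∀ {A : V →ₗ[ℝ] V} {i j : Fin 4}, 0 < sm (A (z i - z j)) →
      ht (fun t => A (z t)) j < ht (fun t => A (z t)) i := by
    intro A i j h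
    rw [map_sub, map_sub] at h
    exact sub_pos.1 h
  have down : ∀ {A : V →ₗ[ℝ] V} {i j : Fin 4}, sm (A (z i - z j)) < 0 →
      ht (fun t => A (z t)) i < ht (fun t => A (z t)) j := by
    intro A i j h
    rw [map_sub, map_sub] at h
    exact sub_neg.1 h
  have h0 : Same k0 (ht z) := by
    apply same_k0
    · exact up (A := LinearMap.id) (g1.coord b01)
    · exact up (A := LinearMap.id) (g2.coord c12)
    · exact up (A := LinearMap.id) (g3.coord a23)
  have hb : Same kb (ht (fun t => S M 1 (z t))) := by
    apply same_kb
    · exact down (by rw [d01]; exact down_S hβ)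
    · exact up (up_S g12 c02 (by decide))
    · exact up (up_S g3 a23 (by decide))
  have hc : Same kc (ht (fun t => S M 2 (z t))) := by
    apply same_kc
    · exact up (up_S g12 b02 (by decide))
    · exact down (by rw [d12]; exact down_S hγ)
    · exact up (up_S g23 a13 (by decide))
  have hbc : Same kbc (ht (fun t => altProd (S M 1) (S M 2) (M 1 2) (z t))) := by
    apply same_kbc
    · refine down ?_
      have := down_alt (hM := hM) (i := 1) (j := 2) (by decide) (p := 0) (q := γ) (by linarith)
      rw [d12]; simpa using this
    · refine down ?_
      have := down_alt (hM := hM) (i := 1) (j := 2) (by decide) (p := β) (q := 0) (by linarith)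
      rw [d01]; simpa using this
    · exact up (up_alt g a03 (by decide) (by decide) _)
  have hac : Same kac (ht (fun t => altProd (S M 0) (S M 2) (M 0 2) (z t))) := by
    apply same_kac
    · exact up (up_alt g b03 (by decide) (by decide) _)
    · refine down ?_
      have := down_alt (hM := hM) (i := 0) (j := 2) (by decide) (p := p) (q := q) (by linarith)
      rw [d23]; exact this
    · refine down ?_
      have := down_alt (hM := hM) (i := 0) (j := 2) (by decide) (p := 0) (q := γ) (by linarith)
      rw [d12]; simpa using this
  have inj : ∀ {k h : Fin 4 → ℝ}, Function.Injective k → Same k h → Function.Injective h := by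
    intro k h hk hs a b hab
    by_contra hne
    rcases lt_or_gt_of_ne (hk.ne hne) with h3 | h3
    · have := (hs _ _).1 h3; exact this.ne hab
    · have := (hs _ _).1 h3; exact this.ne hab.symm
  refine ⟨⟨z, hv⟩, fun f => ⟨?_, ?_, ?_, ?_⟩⟩
  · rw [T_sq, Mh_congr hv.ht_inj h0 hb, Mh_congr (inj kb_inj hb) hb h0, Mh_b]
  · rw [T_sq, Mh_congr hv.ht_inj h0 hc, Mh_congr (inj kc_inj hc) hc h0, Mh_c]
  · rw [Talt_sq (by decide), Mh_congr hv.ht_inj h0 hbc, Mh_congr (inj kbc_inj hbc) hbc h0, Mh_bc]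
  · rw [Talt_sq (by decide), Mh_congr hv.ht_inj h0 hac, Mh_congr (inj kac_inj hac) hac h0, Mh_ac]

end TriArt
end

section
namespace TriArt

theorem alpha_Z : alpha (y 1 * y 2) = y 1 * y 2 := by
  rw [map_mul, alpha_y1, alpha_y2]; group

theorem alpha_surj : Function.Surjective alpha := by
  let β : F →* F := FreeGroup.lift ![(y 1 * y 2)⁻¹ * y 1 * (y 1 * y 2), (y 1 * y 2)⁻¹ * y 2 * (y 1 * y 2), y 3]
  have b1 : β (y 1) = (y 1 * y 2)⁻¹ * y 1 * (y 1 * y 2) := by simp [β, y_1]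
  have b2 : β (y 2) = (y 1 * y 2)⁻¹ * y 2 * (y 1 * y 2) := by simp [β, y_2]
  have b3 : β (y 3) = y 3 := by simp [β, y_3]
  intro f
  refine ⟨β f, ?_⟩
  refine comp_eq (φ := alpha) (ψ := β) (χ := MonoidHom.id F)
    (forall_y (P := fun u => alpha (β u) = MonoidHom.id F u) ?_ ?_ ?_) f
  · rw [b1, map_mul, map_mul, map_inv, alpha_Z, alpha_y1]; simp only [MonoidHom.id_apply]; group
  · rw [b2, map_mul, map_mul, map_inv, alpha_Z, alpha_y2]; simp only [MonoidHom.id_apply]; group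
  · rw [b3, alpha_y3]; rfl

theorem affine_aux {H : Type*} [Group H] (χ : H →* Equiv.Perm ℚ) {A B : H} {k : ℤ}
    (hA : χ A = Equiv.addRight 1) (hB : χ B = Equiv.mulRight₀ 2 two_ne_zero)
    (h : A ^ k * B = B * A ^ k) : k = 0 := by
  have := congrArg χ h
  have hz : ∀ j : ℤ, ∀ x : ℚ, ((Equiv.addRight (1 : ℚ) : Equiv.Perm ℚ) ^ j) x = x + j := by
    intro j
    induction j using Int.induction_on with
    | zero => intro x; simp
    | succ i ih => intro x; rw [zpow_add_one, Equiv.Perm.mul_apply, ih]; simp; ring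
    | pred i ih =>
      intro x
      rw [zpow_sub_one, Equiv.Perm.mul_apply, ih]
      have : (Equiv.addRight (1 : ℚ) : Equiv.Perm ℚ)⁻¹ x = x - 1 := by
        rw [Equiv.Perm.inv_eq_iff_eq]; simp
      rw [this]; push_cast; ring
  rw [map_mul, map_mul, map_zpow, hA, hB] at this
  have := Equiv.congr_fun this 0
  rw [Equiv.Perm.mul_apply, Equiv.Perm.mul_apply, hz, hz] at this
  simp at this
  have h2 : (k : ℚ) = 0 := by linarith
  exact_mod_cast h2

theorem Y_comm {k : ℤ} (h : (y 1 * y 2 * y 3) ^ k * y 3 = y 3 * (y 1 * y 2 * y 3) ^ k) : k = 0 := by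
  refine affine_aux (FreeGroup.lift ![Equiv.addRight 1 * (Equiv.mulRight₀ 2 two_ne_zero)⁻¹, 1,
    Equiv.mulRight₀ 2 two_ne_zero]) ?_ ?_ h
  · simp [y_1, y_2, y_3]
  · simp [y_3]

theorem Z_comm {k : ℤ} (h : (y 1 * y 2) ^ k * y 1 = y 1 * (y 1 * y 2) ^ k) : k = 0 := by
  refine affine_aux (FreeGroup.lift ![Equiv.mulRight₀ 2 two_ne_zero,
    (Equiv.mulRight₀ 2 two_ne_zero)⁻¹ * Equiv.addRight 1, 1]) ?_ ?_ h
  · simp [y_1, y_2]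
  · simp [y_1]

/-- Path RAAG. -/
abbrev GP := RAAG (SimpleGraph.pathGraph 4)

/-- Generators of the RAAG. -/
def xg (i : Fin 4) : GP := PresentedGroup.of i

theorem xg_comm {i j : Fin 4} (h : (SimpleGraph.pathGraph 4).Adj i j) : xg i * xg j = xg j * xg i := by
  have : (PresentedGroup.mk (raagRels (SimpleGraph.pathGraph 4)))
      (FreeGroup.of i * FreeGroup.of j * (FreeGroup.of i)⁻¹ * (FreeGroup.of j)⁻¹) = 1 :=
    PresentedGroup.one_of_mem ⟨i, j, h, rfl⟩
  rw [map_mul, map_mul, map_mul, map_inv, map_inv, mul_inv_eq_one, mul_inv_eq_iff_eq_mul] at this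
  exact this

theorem x01 : xg 0 * xg 1 = xg 1 * xg 0 := xg_comm (by simp [SimpleGraph.pathGraph_adj])
theorem x12 : xg 1 * xg 2 = xg 2 * xg 1 := xg_comm (by simp [SimpleGraph.pathGraph_adj])
theorem x23 : xg 2 * xg 3 = xg 3 * xg 2 := xg_comm (by simp [SimpleGraph.pathGraph_adj])

/-- The free factor. -/
def theta : F →* GP := FreeGroup.lift ![xg 0, xg 1 * (xg 2)⁻¹, xg 3]

theorem theta_0 : theta (y 1) = xg 0 := by simp [theta, y_1]
theorem theta_1 : theta (y 2) = xg 1 * (xg 2)⁻¹ := by simp [theta, y_2]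
theorem theta_2 : theta (y 3) = xg 3 := by simp [theta, y_3]

/-- Conjugation. -/
def kap : F →* F := FreeGroup.lift ![(y 2)⁻¹ * y 1 * y 2, y 2, y 3]
/-- Conjugation. -/
def kap' : F →* F := FreeGroup.lift ![y 2 * y 1 * (y 2)⁻¹, y 2, y 3]

theorem hom_eq {G : Type*} [Group G] {φ ψ : F →* G} (h1 : φ (y 1) = ψ (y 1)) (h2 : φ (y 2) = ψ (y 2))
    (h3 : φ (y 3) = ψ (y 3)) (f : F) : φ f = ψ f := by
  have : φ = ψ := FreeGroup.ext_hom _ _ (forall_y (P := fun u => φ u = ψ u) h1 h2 h3)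
  rw [this]

theorem kap_spec (w : F) : xg 2 * theta w = theta (kap w) * xg 2 := by
  have := hom_eq (φ := (MulAut.conj (xg 2)).toMonoidHom.comp theta) (ψ := theta.comp kap)
    ?_ ?_ ?_ w
  · simp only [MonoidHom.comp_apply, MulEquiv.coe_toMonoidHom, MulAut.conj_apply] at this
    rw [← this]; group
  · have k1 : kap (y 1) = (y 2)⁻¹ * y 1 * y 2 := by simp [kap, y_1]
    simp only [MonoidHom.comp_apply, MulEquiv.coe_toMonoidHom, MulAut.conj_apply, k1, map_mul, map_inv,
      theta_0, theta_1]
    have := x01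
    rw [← mul_inv_eq_iff_eq_mul] at this
    have e1 : (xg 1)⁻¹ * xg 0 * xg 1 = xg 0 := by rw [mul_assoc, x01]; group
    calc _ = xg 2 * ((xg 1)⁻¹ * xg 0 * xg 1) * (xg 2)⁻¹ := by rw [e1]
      _ = _ := by group
  · have k1 : kap (y 2) = y 2 := by simp [kap, y_2]
    simp only [MonoidHom.comp_apply, MulEquiv.coe_toMonoidHom, MulAut.conj_apply, k1, theta_1]
    rw [← mul_assoc, ← x12]; group
  · have k1 : kap (y 3) = y 3 := by simp [kap, y_3]
    simp only [MonoidHom.comp_apply, MulEquiv.coe_toMonoidHom, MulAut.conj_apply, k1, theta_2]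
    rw [x23]; group

theorem kap'_spec (w : F) : (xg 2)⁻¹ * theta w = theta (kap' w) * (xg 2)⁻¹ := by
  have h : kap (kap' w) = w := by
    refine hom_eq (φ := kap.comp kap') (ψ := MonoidHom.id F) ?_ ?_ ?_ w <;>
      simp [kap, kap', y_1, y_2, y_3, mul_assoc]
  have := kap_spec (kap' w)
  rw [h] at this
  rw [inv_mul_eq_iff_eq_mul, ← mul_assoc, this]; group

theorem normal_form (g : GP) : ∃ (w : F) (k : ℤ), g = theta w * xg 2 ^ k := by
  have hg : g ∈ Subgroup.closure (Set.range (PresentedGroup.of (rels := raagRels (SimpleGraph.pathGraph 4)))) := by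
    rw [PresentedGroup.closure_range_of]; trivial
  have A2 : ∀ (w : F) (k : ℤ), xg 2 * (theta w * xg 2 ^ k) = theta (kap w) * xg 2 ^ (k + 1) := by
    intro w k; rw [← mul_assoc, kap_spec, mul_assoc, ← zpow_one_add, add_comm]
  have B2 : ∀ (w : F) (k : ℤ), (xg 2)⁻¹ * (theta w * xg 2 ^ k) = theta (kap' w) * xg 2 ^ (k - 1) := by
    intro w k; rw [← mul_assoc, kap'_spec, mul_assoc]; group
  have x1e : xg 1 = theta (y 2) * xg 2 := by rw [theta_1]; group
  induction hg using Subgroup.closure_induction_left with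
  | one => exact ⟨1, 0, by simp⟩
  | mul_left x hx z hz ih =>
    obtain ⟨i, rfl⟩ := hx
    obtain ⟨w, k, rfl⟩ := ih
    change ∃ w' k', xg i * _ = _
    revert i
    refine forall4 ?_ ?_ ?_ ?_
    · exact ⟨y 1 * w, k, by rw [map_mul, theta_0, mul_assoc]⟩
    · exact ⟨y 2 * kap w, k + 1, by rw [x1e, mul_assoc, A2, map_mul, mul_assoc]⟩
    · exact ⟨_, _, A2 w k⟩
    · exact ⟨y 3 * w, k, by rw [map_mul, theta_2, mul_assoc]⟩
  | inv_mul_cancel x hx z hz ih =>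
    obtain ⟨i, rfl⟩ := hx
    obtain ⟨w, k, rfl⟩ := ih
    change ∃ w' k', (xg i)⁻¹ * _ = _
    revert i
    refine forall4 ?_ ?_ ?_ ?_
    · exact ⟨(y 1)⁻¹ * w, k, by rw [map_mul, map_inv, theta_0, mul_assoc]⟩
    · refine ⟨kap' ((y 2)⁻¹ * w), k - 1, ?_⟩
      rw [← B2, x1e, map_mul, map_inv]; group
    · exact ⟨_, _, B2 w k⟩
    · exact ⟨(y 3)⁻¹ * w, k, by rw [map_mul, map_inv, theta_2, mul_assoc]⟩

/-- Right twisting. -/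
def nn : F →* F := FreeGroup.lift ![(y 1)⁻¹, (y 1 * y 2)⁻¹, y 1 * y 2 * y 3]
/-- exponent. -/
def ee : F →* Multiplicative ℤ := FreeGroup.lift ![1, 1, Multiplicative.ofAdd 1]
/-- Left twisting. -/
def EE : F →* F := (zpowersHom F (y 1 * y 2 * y 3)).comp ee

theorem nn_inj {w : F} (h : nn w = 1) : w = 1 := by
  let r : F →* F := FreeGroup.lift ![(y 1)⁻¹, y 1 * (y 2)⁻¹, y 2 * y 3]
  have h1 : r (nn w) = w := by
    refine hom_eq (φ := r.comp nn) (ψ := MonoidHom.id F) ?_ ?_ ?_ w <;>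
      simp [r, nn, y_1, y_2, y_3, mul_assoc]
  rw [← h1, h, map_one]

theorem injective_of_action {Ω : Type*} (Θ : GP →* Equiv.Perm (Ω × F)) (ω : Ω)
    (h0 : ∀ f, Θ (xg 0) (ω, f) = (ω, f * y 1))
    (h1 : ∀ f, Θ (xg 1) (ω, f) = (ω, alpha f * (y 1 * y 2)))
    (h2 : ∀ f, Θ (xg 2) (ω, f) = (ω, alpha f))
    (h3 : ∀ f, Θ (xg 3) (ω, f) = (ω, (y 1 * y 2 * y 3) * f * (y 1 * y 2 * y 3)⁻¹)) :
    Function.Injective Θ := by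
  rw [injective_iff_map_eq_one]
  intro g hg
  have hs : ∀ f, Θ (xg 1 * (xg 2)⁻¹) (ω, f) = (ω, f * (y 1 * y 2)) := by
    intro f
    obtain ⟨f, rfl⟩ := alpha_surj f
    rw [← h1, ← h2, ← Equiv.Perm.mul_apply, ← map_mul, inv_mul_cancel_right]
  have key : ∀ w f, Θ (theta w) (ω, f) = (ω, EE w * f * (nn w)⁻¹) := by
    have hof : ∀ i : Fin 3, ∀ f, Θ (theta (y i.succ)) (ω, f) = (ω, EE (y i.succ) * f * (nn (y i.succ))⁻¹) := by
      refine forall_y (P := fun u => ∀ f, Θ (theta u) (ω, f) = (ω, EE u * f * (nn u)⁻¹)) ?_ ?_ ?_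
      · intro f; rw [theta_0, h0]; simp [EE, ee, nn, y_1]
      · intro f; rw [theta_1, hs]; simp [EE, ee, nn, y_2, y_1]
      · intro f; rw [theta_2, h3]; simp [EE, ee, nn, y_3, y_1, y_2]
    intro w
    induction w using FreeGroup.induction_on with
    | C1 => intro f; simp
    | of i => exact hof i
    | inv_of i _ =>
      intro f
      rw [map_inv, map_inv, Equiv.Perm.inv_eq_iff_eq]
      have := hof i (EE ((FreeGroup.of i)⁻¹) * f * (nn ((FreeGroup.of i)⁻¹))⁻¹)
      rw [y_succ] at this
      rw [this]
      simp [mul_assoc]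
    | mul u v hu hv =>
      intro f
      rw [map_mul, map_mul, Equiv.Perm.mul_apply, hv, hu, map_mul, map_mul]
      simp [mul_assoc]
  obtain ⟨w, k, rfl⟩ := normal_form g
  have fix : ∀ f, alpha f = f → EE w * f * (nn w)⁻¹ = f := by
    intro f hf
    have e1 : Θ (xg 2) (ω, f) = (ω, f) := by rw [h2, hf]
    have e2 := Equiv.Perm.zpow_apply_eq_self_of_apply_eq_self e1 k
    have e3 := Equiv.congr_fun hg (ω, f)
    rw [map_mul, map_zpow, Equiv.Perm.mul_apply, e2, key] at e3
    exact congrArg Prod.snd e3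
  have f1 := fix 1 (map_one _)
  have f2 := fix (y 3) alpha_y3
  rw [mul_one, mul_inv_eq_one] at f1
  rw [← f1, mul_inv_eq_iff_eq_mul] at f2
  have f3 : ee w = 1 := by
    have : EE w = (y 1 * y 2 * y 3) ^ (Multiplicative.toAdd (ee w)) := by simp [EE, zpowersHom_apply]
    rw [this] at f2
    exact Multiplicative.toAdd.injective (Y_comm f2)
  have f4 : EE w = 1 := by simp [EE, f3]
  have f5 : w = 1 := nn_inj (by rw [← f1, f4])
  subst f5
  have g1 : ∀ j : ℤ, Θ (xg 2 ^ j) (ω, y 1) = (ω, (y 1 * y 2) ^ j * y 1 * ((y 1 * y 2) ^ j)⁻¹) := by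
    have step : ∀ j : ℤ, Θ (xg 2) (ω, (y 1 * y 2) ^ j * y 1 * ((y 1 * y 2) ^ j)⁻¹) =
        (ω, (y 1 * y 2) ^ (j + 1) * y 1 * ((y 1 * y 2) ^ (j + 1))⁻¹) := by
      intro j
      rw [h2, map_mul, map_mul, map_inv, map_zpow, alpha_Z, alpha_y1, zpow_add_one]
      simp [mul_assoc]
    intro j
    induction j using Int.induction_on with
    | zero => simp
    | succ i ih => rw [add_comm, zpow_one_add, map_mul, Equiv.Perm.mul_apply, ih, step, add_comm]
    | pred i ih =>
      rw [sub_eq_neg_add, zpow_add, zpow_neg_one, map_mul, map_inv, Equiv.Perm.mul_apply, ih,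
        Equiv.Perm.inv_eq_iff_eq, step]
      congr 4 <;> ring_nf
  have e3 := Equiv.congr_fun hg (ω, y 1)
  rw [map_one, one_mul, g1] at e3
  have e4 : (y 1 * y 2) ^ k * y 1 * ((y 1 * y 2) ^ k)⁻¹ = y 1 := congrArg Prod.snd e3
  rw [mul_inv_eq_iff_eq_mul] at e4
  rw [Z_comm e4]; simp

end TriArt
end

section
open Real
namespace TriArt
variable (M : CoxeterMatrix (Fin 3)) (hM : ∀ i j, i ≠ j → 2 ≤ M i j)

/-- Good in coordinates. -/
def G3 (x y z : ℝ) : Prop := Good M hM (x • e 0 + y • e 1 + z • e 2)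

variable {M hM}

theorem bil0 (x y z : ℝ) : bil M 0 (x • e 0 + y • e 1 + z • e 2) = K M 0 1 * y + K M 0 2 * z - 2 * x := by
  simp only [map_add, map_smul, bil_self, bil_ne M (show (0 : Fin 3) ≠ 1 by decide),
    bil_ne M (show (0 : Fin 3) ≠ 2 by decide), smul_eq_mul]; ring

theorem bil1 (x y z : ℝ) : bil M 1 (x • e 0 + y • e 1 + z • e 2) = K M 0 1 * x + K M 1 2 * z - 2 * y := by
  simp only [map_add, map_smul, bil_self, bil_ne M (show (1 : Fin 3) ≠ 0 by decide),
    bil_ne M (show (1 : Fin 3) ≠ 2 by decide), smul_eq_mul, K_symm M 1 0]; ring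

theorem bil2 (x y z : ℝ) : bil M 2 (x • e 0 + y • e 1 + z • e 2) = K M 0 2 * x + K M 1 2 * y - 2 * z := by
  simp only [map_add, map_smul, bil_self, bil_ne M (show (2 : Fin 3) ≠ 0 by decide),
    bil_ne M (show (2 : Fin 3) ≠ 1 by decide), smul_eq_mul, K_symm M 2 0, K_symm M 2 1]; ring

theorem G3.of0 {x y z x' : ℝ} (h : G3 M hM x' y z) (hx : x' = K M 0 1 * y + K M 0 2 * z - x) :
    G3 M hM x y z := by
  apply Good.of_S 0
  rw [S_apply, bil0]
  have : x • e 0 + y • e 1 + z • e 2 + (K M 0 1 * y + K M 0 2 * z - 2 * x) • e 0 =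
    x' • e 0 + y • e 1 + z • e 2 := by rw [hx]; module
  rw [this]; exact h

theorem G3.of1 {x y z y' : ℝ} (h : G3 M hM x y' z) (hx : y' = K M 0 1 * x + K M 1 2 * z - y) :
    G3 M hM x y z := by
  apply Good.of_S 1
  rw [S_apply, bil1]
  have : x • e 0 + y • e 1 + z • e 2 + (K M 0 1 * x + K M 1 2 * z - 2 * y) • e 1 =
    x • e 0 + y' • e 1 + z • e 2 := by rw [hx]; module
  rw [this]; exact h

theorem G3.of2 {x y z z' : ℝ} (h : G3 M hM x y z') (hx : z' = K M 0 2 * x + K M 1 2 * y - z) :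
    G3 M hM x y z := by
  apply Good.of_S 2
  rw [S_apply, bil2]
  have : x • e 0 + y • e 1 + z • e 2 + (K M 0 2 * x + K M 1 2 * y - 2 * z) • e 2 =
    x • e 0 + y • e 1 + z' • e 2 := by rw [hx]; module
  rw [this]; exact h

theorem g3_0 {x : ℝ} (hx : 0 < x) : G3 M hM x 0 0 := by
  have := (good_e (M := M) (hM := hM) 0).smul hx
  simpa [G3] using this
theorem g3_1 {x : ℝ} (hx : 0 < x) : G3 M hM 0 x 0 := by
  have := (good_e (M := M) (hM := hM) 1).smul hx
  simpa [G3] using this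
theorem g3_2 {x : ℝ} (hx : 0 < x) : G3 M hM 0 0 x := by
  have := (good_e (M := M) (hM := hM) 2).smul hx
  simpa [G3] using this

theorem g3_anti {x y z : ℝ} (hx : 0 < x) (hy : 0 < y) (hz : 0 < z)
    (h0 : 0 ≤ K M 0 1 * y + K M 0 2 * z - 2 * x) (h1 : 0 ≤ K M 0 1 * x + K M 1 2 * z - 2 * y)
    (h2 : 0 ≤ K M 0 2 * x + K M 1 2 * y - 2 * z) : G3 M hM x y z := by
  apply good_antidominant
  · exact add_nonneg (add_nonneg (smul_nonneg hx.le (e_nonneg 0)) (smul_nonneg hy.le (e_nonneg 1)))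
      (smul_nonneg hz.le (e_nonneg 2))
  · intro h
    have := congrFun h 0
    simp [e] at this
    linarith
  · intro s
    fin_cases s
    · exact (bil0 x y z).symm ▸ h0
    · exact (bil1 x y z).symm ▸ h1
    · exact (bil2 x y z).symm ▸ h2

/-- The data needed. -/
def HasData (M : CoxeterMatrix (Fin 3)) (hM : ∀ i j, i ≠ j → 2 ≤ M i j) : Prop :=
  ∃ β γ p q : ℝ, 0 < β ∧ 0 < γ ∧ 0 < p ∧ 0 ≤ q ∧ G3 M hM p 0 q ∧ G3 M hM 0 β γ ∧
    G3 M hM p 0 (γ + q) ∧ G3 M hM p β (γ + q)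

theorem data_m4 (hl : 0 ≤ K M 0 1) (hm0 : 0 < K M 1 2) (hn0 : 0 < K M 0 2)
    (hm : 2 ≤ K M 1 2 ^ 2) (hn : 2 ≤ K M 0 2 ^ 2) : HasData M hM := by
  have i1 : 0 < (K M 1 2)⁻¹ := inv_pos.2 hm0
  have i2 : 0 < (K M 0 2)⁻¹ := inv_pos.2 hn0
  have c1 : K M 1 2 * (K M 1 2)⁻¹ = 1 := mul_inv_cancel₀ hm0.ne'
  have c2 : K M 0 2 * (K M 0 2)⁻¹ = 1 := mul_inv_cancel₀ hn0.ne'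
  have d1 : 2 * (K M 1 2)⁻¹ ≤ K M 1 2 := by
    rw [← div_eq_mul_inv, div_le_iff₀ hm0]; nlinarith
  have d2 : 2 * (K M 0 2)⁻¹ ≤ K M 0 2 := by
    rw [← div_eq_mul_inv, div_le_iff₀ hn0]; nlinarith
  refine ⟨(K M 1 2)⁻¹, 1, (K M 0 2)⁻¹, 0, i1, one_pos, i2, le_rfl, g3_0 i2, ?_, ?_, ?_⟩
  · exact (g3_1 i1).of2 (by linarith)
  · exact (g3_0 i2).of2 (by linarith)
  · refine g3_anti i2 i1 (by norm_num) ?_ ?_ ?_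
    · have := mul_nonneg hl i1.le; linarith
    · have := mul_nonneg hl i2.le; linarith
    · linarith

theorem data_33 (hl : K M 0 1 = 1) (hm : K M 1 2 = 1) (hn : 1 ≤ K M 0 2) : HasData M hM := by
  have hn0 : 0 < K M 0 2 := by linarith
  have i2 : 0 < (K M 0 2)⁻¹ := inv_pos.2 hn0
  have c2 : K M 0 2 * (K M 0 2)⁻¹ = 1 := mul_inv_cancel₀ hn0.ne'
  have d2 : (K M 0 2)⁻¹ ≤ 1 := inv_le_one_of_one_le₀ hn
  refine ⟨1, 1, (K M 0 2)⁻¹, 0, one_pos, one_pos, i2, le_rfl, g3_0 i2, ?_, ?_, ?_⟩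
  · exact (g3_1 one_pos).of2 (by linarith)
  · exact (g3_0 i2).of2 (by linarith)
  · refine G3.of1 (G3.of2 (z' := (K M 0 2)⁻¹) (y := (K M 0 2)⁻¹) ?_ ?_) ?_
    · refine g3_anti i2 i2 i2 ?_ ?_ ?_ <;> (try rw [hl]) <;> (try rw [hm]) <;> linarith
    · rw [hm]; linarith
    · rw [hl, hm]; linarith

theorem data_233 (hl : K M 0 1 = 0) (hm : K M 1 2 = 1) (hn : K M 0 2 = 1) : HasData M hM := by
  have h1 : G3 M hM 1 0 1 := (g3_0 one_pos).of2 (by linarith)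
  refine ⟨1, 1, 1, 0, one_pos, one_pos, one_pos, le_rfl, g3_0 one_pos, ?_, ?_, ?_⟩
  · exact (g3_1 one_pos).of2 (by linarith)
  · rw [add_zero]; exact h1
  · rw [add_zero]; exact h1.of1 (by linarith)

theorem data_235 (hl : K M 0 1 = 0) (hm : K M 1 2 = 1) (hn1 : 1 < K M 0 2)
    (hn : K M 0 2 ^ 2 = K M 0 2 + 1) : HasData M hM := by
  have h1 : G3 M hM 1 0 1 :=
    ((g3_2 (sub_pos.2 hn1)).of0 (x := 1) (by linear_combination -hn)).of2 (by ring)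
  refine ⟨1, 1, 1, 0, one_pos, one_pos, one_pos, le_rfl, g3_0 one_pos, ?_, ?_, ?_⟩
  · exact (g3_1 one_pos).of2 (by linarith)
  · rw [add_zero]; exact h1
  · rw [add_zero]; exact h1.of1 (by linarith)

theorem data_234 (hl : K M 0 1 = 0) (hm : K M 1 2 = 1) (hn0 : 0 < K M 0 2) : HasData M hM := by
  have h1 : G3 M hM 0 1 1 := (g3_1 one_pos).of2 (by linarith)
  refine ⟨1, 1, K M 0 2, 0, one_pos, one_pos, hn0, le_rfl, g3_0 hn0, h1, ?_, ?_⟩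
  · rw [add_zero]; exact (g3_2 one_pos).of0 (by linarith)
  · rw [add_zero]; exact h1.of0 (by rw [hl]; linarith)

theorem data_236 (hl : K M 0 1 = 0) (hm : K M 1 2 = 1) (hn0 : 0 < K M 0 2) (hn : 3 ≤ K M 0 2 ^ 2) :
    HasData M hM := by
  set k := K M 0 2 with hk
  have hd : 0 < k ^ 2 - 2 := by linarith
  obtain ⟨d, hdd⟩ : ∃ d, d = (k ^ 2 - 2)⁻¹ := ⟨_, rfl⟩
  have d0 : 0 < d := hdd ▸ inv_pos.2 hd
  have dd : k ^ 2 * d = 1 + 2 * d := by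
    have : (k ^ 2 - 2) * d = 1 := hdd ▸ mul_inv_cancel₀ hd.ne'
    linarith
  have kd : 0 < k * d := mul_pos hn0 d0
  have h1 : G3 M hM (k * d) 0 d := (g3_2 d0).of0 (by rw [← hk]; ring)
  refine ⟨1, 1, k * d, d, one_pos, one_pos, kd, d0.le, h1, ?_, ?_, ?_⟩
  · exact (g3_1 one_pos).of2 (by linarith)
  · exact h1.of2 (by rw [← hk]; linear_combination -dd)
  · refine G3.of1 (G3.of2 (z' := 2 * d) (y := d) ?_ ?_) ?_
    · refine g3_anti kd d0 (by linarith) ?_ ?_ ?_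
      · rw [hl, ← hk]; nlinarith
      · rw [hl, hm]; nlinarith
      · rw [hm, ← hk]; nlinarith
    · rw [hm, ← hk]; linear_combination -dd
    · rw [hm, hl]; ring

theorem two_cos_mono {i j : ℕ} (hi : 1 ≤ i) (h : i ≤ j) : 2 * cos (π / i) ≤ 2 * cos (π / j) := by
  have hi' : (1 : ℝ) ≤ i := by exact_mod_cast hi
  have hj' : (i : ℝ) ≤ j := by exact_mod_cast h
  have : cos (π / i) ≤ cos (π / j) := by
    apply cos_le_cos_of_nonneg_of_le_pi
    · positivity
    · rw [div_le_iff₀ (by linarith)]; nlinarith [pi_pos]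
    · exact div_le_div_of_nonneg_left pi_pos.le (by linarith) hj'
  linarith

theorem kv2 : 2 * cos (π / (2 : ℕ)) = 0 := by norm_num
theorem kv3 : 2 * cos (π / (3 : ℕ)) = 1 := by norm_num
theorem kv4 : 2 * cos (π / (4 : ℕ)) = √2 := by push_cast; rw [cos_pi_div_four]; ring
theorem kv6 : 2 * cos (π / (6 : ℕ)) = √3 := by push_cast; rw [cos_pi_div_six]; ring
theorem kv5 : 2 * cos (π / (5 : ℕ)) = (1 + √5) / 2 := by push_cast; rw [cos_pi_div_five]; ring

theorem hasData (h1 : M 0 1 ≤ M 1 2) (h2 : M 1 2 ≤ M 0 2) (h3 : 3 ≤ M 1 2) : HasData M hM := by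
  have hl := hM 0 1 (by decide)
  have mon : ∀ {i : ℕ} {a b : Fin 3}, 1 ≤ i → i ≤ M a b → 2 * cos (π / i) ≤ K M a b :=
    fun h h' => two_cos_mono h h'
  have val : ∀ {i : ℕ} {a b : Fin 3}, M a b = i → K M a b = 2 * cos (π / i) := by
    rintro i a b rfl; rfl
  have sq : ∀ {a : ℝ} {k : ℝ}, 0 < a → √a ≤ k → a ≤ k ^ 2 := by
    intro a k ha h
    calc a = √a ^ 2 := (sq_sqrt ha.le).symm
      _ ≤ _ := by gcongr
  have hn1 : 1 ≤ K M 0 2 := by rw [← kv3]; exact mon (by norm_num) (by omega)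
  have hm1 : 1 ≤ K M 1 2 := by rw [← kv3]; exact mon (by norm_num) (by omega)
  by_cases hm : 4 ≤ M 1 2
  · apply data_m4
    · exact K_nonneg M hM (by decide)
    · linarith
    · linarith
    · apply sq two_pos; rw [← kv4]; exact mon (by norm_num) (by omega)
    · apply sq two_pos; rw [← kv4]; exact mon (by norm_num) (by omega)
  have hm3 : M 1 2 = 3 := by omega
  have km : K M 1 2 = 1 := by rw [val hm3, kv3]
  by_cases hl3 : M 0 1 = 3
  · exact data_33 (by rw [val hl3, kv3]) km hn1
  have hl2 : M 0 1 = 2 := by omega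
  have kl : K M 0 1 = 0 := by rw [val hl2, kv2]
  by_cases h6 : 6 ≤ M 0 2
  · refine data_236 kl km (by linarith) ?_
    apply sq three_pos; rw [← kv6]; exact mon (by norm_num) h6
  obtain h | h | h : M 0 2 = 3 ∨ M 0 2 = 4 ∨ M 0 2 = 5 := by omega
  · exact data_233 kl km (by rw [val h, kv3])
  · exact data_234 kl km (by linarith)
  · have s5 : √5 ^ 2 = 5 := sq_sqrt (by norm_num)
    refine data_235 kl km ?_ ?_
    · rw [val h, kv5]; nlinarith [sqrt_nonneg 5]
    · rw [val h, kv5]; nlinarith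

theorem exists_base (h1 : M 0 1 ≤ M 1 2) (h2 : M 1 2 ≤ M 0 2) (h3 : 3 ≤ M 1 2) :
    ∃ ω : Om M hM, ∀ f, T M hM 1 (T M hM 1 (ω, f)) = (ω, f * y 1) ∧
      T M hM 2 (T M hM 2 (ω, f)) = (ω, alpha f) ∧
      altProd (T M hM 1) (T M hM 2) (M 1 2) (altProd (T M hM 1) (T M hM 2) (M 1 2) (ω, f)) =
        (ω, alpha f * (y 1 * y 2)) ∧
      altProd (T M hM 0) (T M hM 2) (M 0 2) (altProd (T M hM 0) (T M hM 2) (M 0 2) (ω, f)) =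
        (ω, (y 1 * y 2 * y 3) * f * (y 1 * y 2 * y 3)⁻¹) := by
  obtain ⟨β, γ, p, q, hβ, hγ, hp, hq, g3, g12, g23, g⟩ := hasData (hM := hM) h1 h2 h3
  refine base M hM hβ hγ hp hq ?_ ?_ ?_ ?_
  · unfold G3 at g3; convert g3 using 1; module
  · unfold G3 at g12; convert g12 using 1; module
  · unfold G3 at g23; convert g23 using 1; module
  · unfold G3 at g; convert g using 1; module

end TriArt
end

section
namespace TriArt

theorem alt_comm {G : Type*} [Monoid G] {u v : G} {n : ℕ} (h : altProd u v n = altProd v u n) :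
    u * altProd u v n ^ 2 = altProd u v n ^ 2 * u ∧ v * altProd u v n ^ 2 = altProd u v n ^ 2 * v := by
  have h1 : u * altProd u v n = altProd u v n * (if n % 2 = 0 then u else v) := by
    rw [← altProd_succ', altProd_succ, h]
  have h2 : v * altProd u v n = altProd u v n * (if n % 2 = 0 then v else u) := by
    rw [← altProd_succ, altProd_succ', h]
  rw [pow_two]
  split_ifs at h1 h2
  · constructor
    · rw [← mul_assoc, h1, mul_assoc, h1, mul_assoc]
    · rw [← mul_assoc, h2, mul_assoc, h2, mul_assoc]
  · constructor
    · rw [← mul_assoc, h1, mul_assoc, h2, mul_assoc]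
    · rw [← mul_assoc, h2, mul_assoc, h1, mul_assoc]

theorem artin_braid {W : Type*} {Γ : SimpleGraph W} {ℓ : W → W → ℕ} {u v : W} (h : Γ.Adj u v) :
    altProd (PresentedGroup.of u : ArtinGroup Γ ℓ) (PresentedGroup.of v) (ℓ u v) =
      altProd (PresentedGroup.of v) (PresentedGroup.of u) (ℓ u v) := by
  have : (PresentedGroup.mk (artinRels Γ ℓ))
      (altProd (FreeGroup.of u) (FreeGroup.of v) (ℓ u v) *
        (altProd (FreeGroup.of v) (FreeGroup.of u) (ℓ u v))⁻¹) = 1 :=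
    PresentedGroup.one_of_mem ⟨u, v, h, rfl⟩
  rw [map_mul, map_inv, mul_inv_eq_one, map_altProd, map_altProd] at this
  exact this

/-- The Coxeter matrix of the triangle. -/
def triM (l m n : ℕ) (hl : 2 ≤ l) (hm : 2 ≤ m) (hn : 2 ≤ n) : CoxeterMatrix (Fin 3) where
  M := Matrix.of fun i j => if i = j then 1 else triLabel l m n i j
  isSymm := by
    ext i j
    fin_cases i <;> fin_cases j <;> simp [triLabel]
  diagonal i := by simp
  off_diagonal i j h := by
    simp only [Matrix.of_apply, if_neg h, triLabel]
    split_ifs <;> omega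

theorem triM_ne (l m n : ℕ) (hl : 2 ≤ l) (hm : 2 ≤ m) (hn : 2 ≤ n) (i j : Fin 3) (h : i ≠ j) :
    triLabel l m n i j = triM l m n hl hm hn i j := by
  simp [triM, h]

theorem triM_ge (l m n : ℕ) (hl : 2 ≤ l) (hm : 2 ≤ m) (hn : 2 ≤ n) (i j : Fin 3) (h : i ≠ j) :
    2 ≤ triM l m n hl hm hn i j := by
  rw [← triM_ne l m n hl hm hn i j h, triLabel]
  split_ifs <;> assumption

theorem range_aux {H : Type*} [Group H] (f : GP →* H) :
    f.range = Subgroup.closure {f (PresentedGroup.of 0), f (PresentedGroup.of 1),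
      f (PresentedGroup.of 2), f (PresentedGroup.of 3)} := by
  rw [MonoidHom.range_eq_map, ← PresentedGroup.closure_range_of, MonoidHom.map_closure]
  congr 1
  ext x
  constructor
  · rintro ⟨_, ⟨i, rfl⟩, rfl⟩
    revert i
    refine forall4 ?_ ?_ ?_ ?_ <;> simp
  · rintro (rfl | rfl | rfl | rfl)
    · exact ⟨_, ⟨0, rfl⟩, rfl⟩
    · exact ⟨_, ⟨1, rfl⟩, rfl⟩
    · exact ⟨_, ⟨2, rfl⟩, rfl⟩
    · exact ⟨_, ⟨3, rfl⟩, rfl⟩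

theorem exists_hom {H : Type*} [Group H] (a b c d : H) (hab : a * b = b * a) (hbc : b * c = c * b)
    (hcd : c * d = d * c) : ∃ f : GP →* H, f (xg 0) = a ∧ f (xg 1) = b ∧ f (xg 2) = c ∧ f (xg 3) = d := by
  have hr : ∀ r ∈ raagRels (SimpleGraph.pathGraph 4), FreeGroup.lift ![a, b, c, d] r = 1 := by
    rintro r ⟨u, v, huv, rfl⟩
    rw [map_mul, map_mul, map_mul, map_inv, map_inv, mul_inv_eq_one, mul_inv_eq_iff_eq_mul]
    simp only [FreeGroup.lift_apply_of]
    revert u v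
    refine forall4 ?_ ?_ ?_ ?_ <;> refine forall4 ?_ ?_ ?_ ?_ <;> intro huv <;>
      first
      | (exfalso; revert huv; simp [SimpleGraph.pathGraph_adj]; done)
      | exact hab
      | exact hab.symm
      | exact hbc
      | exact hbc.symm
      | exact hcd
      | exact hcd.symm
  refine ⟨PresentedGroup.toGroup hr, ?_, ?_, ?_, ?_⟩ <;> exact PresentedGroup.toGroup.of hr

theorem main_thm (l m n : ℕ) (hl : 2 ≤ l) (hlm : l ≤ m) (hmn : m ≤ n)
    (hm : 2 < m) (hn : 2 < n)
    (zbc zac : ArtinGroup (⊤ : SimpleGraph (Fin 3)) (triLabel l m n))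
    (hzbc : zbc = altProd (PresentedGroup.of 1) (PresentedGroup.of 2) m)
    (hzac : zac = altProd (PresentedGroup.of 0) (PresentedGroup.of 2) n) :
    ∃ f : RAAG (SimpleGraph.pathGraph 4) →*
        ArtinGroup (⊤ : SimpleGraph (Fin 3)) (triLabel l m n),
      Function.Injective f ∧
      f (PresentedGroup.of 0) = (PresentedGroup.of 1) ^ 2 ∧
      f (PresentedGroup.of 1) = zbc ^ 2 ∧
      f (PresentedGroup.of 2) = (PresentedGroup.of 2) ^ 2 ∧
      f (PresentedGroup.of 3) = zac ^ 2 ∧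
      f.range = Subgroup.closure
        ({(PresentedGroup.of 1) ^ 2, zbc ^ 2, (PresentedGroup.of 2) ^ 2, zac ^ 2} :
          Set (ArtinGroup (⊤ : SimpleGraph (Fin 3)) (triLabel l m n))) := by
  have hm' : 2 ≤ m := hm.le
  have hn' : 2 ≤ n := hn.le
  let M := triM l m n hl hm' hn'
  have hM : ∀ i j, i ≠ j → 2 ≤ M i j := triM_ge l m n hl hm' hn'
  have e01 : M 0 1 = l := rfl
  have e12 : M 1 2 = m := rfl
  have e02 : M 0 2 = n := rfl
  obtain ⟨Ψ, hΨ⟩ := exists_action M hM (triLabel l m n) (triM_ne l m n hl hm' hn')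
  obtain ⟨ω, hω⟩ := exists_base (M := M) (hM := hM) (by rw [e01, e12]; exact hlm)
    (by rw [e02, e12]; exact hmn) (by rw [e12]; exact hm)
  have b12 := alt_comm (artin_braid (Γ := (⊤ : SimpleGraph (Fin 3))) (ℓ := triLabel l m n)
    (u := 1) (v := 2) (by simp))
  have b02 := alt_comm (artin_braid (Γ := (⊤ : SimpleGraph (Fin 3))) (ℓ := triLabel l m n)
    (u := 0) (v := 2) (by simp))
  have t12 : triLabel l m n 1 2 = m := rfl
  have t02 : triLabel l m n 0 2 = n := rfl
  rw [t12, ← hzbc] at b12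
  rw [t02, ← hzac] at b02
  obtain ⟨f, f0, f1, f2, f3⟩ := exists_hom
    ((PresentedGroup.of 1 : ArtinGroup (⊤ : SimpleGraph (Fin 3)) (triLabel l m n)) ^ 2)
    (zbc ^ 2) ((PresentedGroup.of 2) ^ 2) (zac ^ 2)
    (Commute.pow_left (show Commute _ _ from b12.1) 2)
    (Commute.pow_left (show Commute _ _ from b12.2) 2).symm
    (Commute.pow_left (show Commute _ _ from b02.2) 2)
  refine ⟨f, ?_, f0, f1, f2, f3, ?_⟩
  · have inj : Function.Injective (Ψ.comp f) := by
      refine injective_of_action (Ψ.comp f) ω ?_ ?_ ?_ ?_ <;> intro g <;>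
        rw [MonoidHom.comp_apply]
      · rw [f0, map_pow, hΨ, pow_two, Equiv.Perm.mul_apply]; exact (hω g).1
      · rw [f1, hzbc, map_pow, map_altProd, hΨ, hΨ, pow_two, Equiv.Perm.mul_apply]
        exact (hω g).2.2.1
      · rw [f2, map_pow, hΨ, pow_two, Equiv.Perm.mul_apply]; exact (hω g).2.1
      · rw [f3, hzac, map_pow, map_altProd, hΨ, hΨ, pow_two, Equiv.Perm.mul_apply]
        exact (hω g).2.2.2
    intro x y hxy
    exact inj (by rw [MonoidHom.comp_apply, MonoidHom.comp_apply, hxy])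
  · rw [range_aux]
    change Subgroup.closure {f (xg 0), f (xg 1), f (xg 2), f (xg 3)} = _
    rw [f0, f1, f2, f3]

end TriArt
end

/-- For `2 ≤ l ≤ m ≤ n` with `m > 2` and `n > 2`, the right-angled Artin
group `A(P₄)` embeds into the triangle Artin group `A(Δ_{l,m,n})`: writing `z_{bc} = (b,c)_m`
and `z_{ac} = (a,c)_n`, the subgroup generated by `b², z_{bc}², c², z_{ac}²` is isomorphic to
`A(P₄)`. -/
theorem stmt_12 (l m n : ℕ) (hl : 2 ≤ l) (hlm : l ≤ m) (hmn : m ≤ n)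
    (hm : 2 < m) (hn : 2 < n)
    (zbc zac : ArtinGroup (⊤ : SimpleGraph (Fin 3)) (triLabel l m n))
    (hzbc : zbc = altProd (PresentedGroup.of 1) (PresentedGroup.of 2) m)
    (hzac : zac = altProd (PresentedGroup.of 0) (PresentedGroup.of 2) n) :
    ∃ f : RAAG (SimpleGraph.pathGraph 4) →*
        ArtinGroup (⊤ : SimpleGraph (Fin 3)) (triLabel l m n),
      Function.Injective f ∧
      f (PresentedGroup.of 0) = (PresentedGroup.of 1) ^ 2 ∧
      f (PresentedGroup.of 1) = zbc ^ 2 ∧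
      f (PresentedGroup.of 2) = (PresentedGroup.of 2) ^ 2 ∧
      f (PresentedGroup.of 3) = zac ^ 2 ∧
      f.range = Subgroup.closure
        ({(PresentedGroup.of 1) ^ 2, zbc ^ 2, (PresentedGroup.of 2) ^ 2, zac ^ 2} :
          Set (ArtinGroup (⊤ : SimpleGraph (Fin 3)) (triLabel l m n))) := by
  exact TriArt.main_thm l m n hl hlm hmn hm hn zbc zac hzbc hzac
end

section
/- (Kambites.) A right-angled Artin group A(Γ) contains a subgroup isomorphic to A(C_4) if and only if the finite simplicial graph Γ contains C_4 as an induced subgraph. -/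
/-- The simplicial graph `Γ` contains the cycle `C₄` on four vertices as an induced
subgraph. -/
def HasInducedC4 {V : Type*} (Γ : SimpleGraph V) : Prop :=
  ∃ φ : Fin 4 → V, Function.Injective φ ∧
    ∀ i j, Γ.Adj (φ i) (φ j) ↔ (SimpleGraph.cycleGraph 4).Adj i j

namespace Kamb

open FreeGroup

section Free
variable {X : Type*}

lemma cyc_rot {a : X × Bool} {t : List (X × Bool)} (h : IsCyclicallyReduced (a :: t)) :
    IsCyclicallyReduced (t ++ [a]) := by
  obtain ⟨h1, h2⟩ := h
  cases t with
  | nil => simp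
  | cons b s =>
    unfold IsCyclicallyReduced FreeGroup.IsReduced at *
    rw [List.isChain_cons_cons] at h1
    refine ⟨?_, ?_⟩
    · rw [List.isChain_append]
      refine ⟨h1.2, by simp, ?_⟩
      intro x hx y hy
      refine h2 x ?_ y (by simpa using hy)
      rw [List.getLast?_cons_cons]; exact hx
    · intro x hx y hy
      rw [List.getLast?_concat] at hx
      simp at hx hy
      subst hx hy
      exact h1.1

lemma cyc_rot' {a : X × Bool} {t : List (X × Bool)} (h : IsCyclicallyReduced (t ++ [a])) :
    IsCyclicallyReduced (a :: t) := by
  obtain ⟨h1, h2⟩ := h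
  cases t with
  | nil => simp
  | cons b s =>
    unfold IsCyclicallyReduced FreeGroup.IsReduced at *
    rw [List.isChain_append] at h1
    refine ⟨?_, ?_⟩
    · rw [List.isChain_cons_cons]
      exact ⟨h2 a (by rw [List.getLast?_concat]; rfl) b (by simp), h1.1⟩
    · intro x hx y hy
      rw [List.getLast?_cons_cons] at hx
      simp at hy
      subst hy
      exact h1.2.2 x hx a (by simp)

lemma conj_rot [DecidableEq X] (w : List (X × Bool)) : ∀ (l l' : List (X × Bool)), IsReduced w →
    IsCyclicallyReduced l → IsCyclicallyReduced l' →
    mk w * mk l' * (mk w)⁻¹ = mk l → l' ~r l := by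
  induction w using List.reverseRecOn with
  | nil =>
    intro l l' _ hl hl' h
    rw [← one_eq_mk] at h
    simp only [one_mul, inv_one, mul_one] at h
    have := congrArg toWord h
    rw [toWord_mk, toWord_mk, hl.isReduced.reduce_eq, hl'.isReduced.reduce_eq] at this
    rw [this]
  | append_singleton w x ih =>
    intro l l' hw hl hl' h
    have hw' : IsReduced w := hw.infix ⟨[], [x], by simp⟩
    obtain ⟨a, e⟩ := x
    by_cases h0 : l' = []
    · subst h0
      rw [← one_eq_mk] at h
      simp only [mul_one, mul_inv_cancel] at h
      have := congrArg toWord h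
      rw [toWord_mk, hl.isReduced.reduce_eq, toWord_one] at this
      rw [← this]
    by_cases h1 : l'.head? = some (a, !e)
    · obtain ⟨t, rfl⟩ : ∃ t, l' = (a, !e) :: t := by
        cases l' with
        | nil => simp at h0
        | cons b t => simp at h1; exact ⟨t, by rw [h1]⟩
      have := ih l (t ++ [(a, !e)]) hw' hl (cyc_rot hl') (by
        rw [← h, ← mul_mk, ← mul_mk, show (a, !e) :: t = [(a, !e)] ++ t from rfl, ← mul_mk]
        have : (mk [(a, !e)] : FreeGroup X) = (mk [(a,e)])⁻¹ := by simp [inv_mk, invRev]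
        rw [this]; group)
      refine List.IsRotated.trans ?_ this
      exact ⟨1, by simp⟩
    by_cases h2 : l'.getLast? = some (a, e)
    · obtain ⟨t, rfl⟩ : ∃ t, l' = t ++ [(a, e)] := by
        obtain ⟨t, b, rfl⟩ := (List.eq_nil_or_concat' l').resolve_left h0
        simp at h2; exact ⟨t, by rw [h2]⟩
      have := ih l ((a, e) :: t) hw' hl (cyc_rot' hl') (by
        rw [← h, ← mul_mk, ← mul_mk, show (a, e) :: t = [(a, e)] ++ t from rfl, ← mul_mk]
        group)
      refine List.IsRotated.trans ?_ this
      exact List.IsRotated.symm ⟨1, by simp⟩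
    · exfalso
      have hinv : IsReduced (invRev (w ++ [(a, e)])) := by
        rw [isReduced_iff_reduce_eq, reduce_invRev, hw.reduce_eq]
      have hred : IsReduced ((w ++ [(a, e)]) ++ l' ++ invRev (w ++ [(a, e)])) := by
        unfold FreeGroup.IsReduced at *
        rw [List.isChain_append, List.isChain_append]
        have hh : ∀ y ∈ l'.head?, a = y.1 → e = y.2 := by
          rintro ⟨y, f⟩ hy rfl
          simp only [Option.mem_def] at hy
          rw [hy] at h1
          cases e <;> cases f <;> simp_all
        have ht : ∀ y ∈ l'.getLast?, y.1 = a → y.2 = !e := by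
          rintro ⟨y, f⟩ hy rfl
          simp only [Option.mem_def] at hy
          rw [hy] at h2
          cases e <;> cases f <;> simp_all
        refine ⟨⟨hw, hl'.1, ?_⟩, hinv, ?_⟩
        · intro x hx y hy
          simp at hx; subst hx
          exact hh y hy
        · intro x hx y hy
          rw [List.getLast?_append_of_ne_nil _ h0] at hx
          simp [invRev] at hy; subst hy
          exact ht x hx
      have hE : l = (w ++ [(a, e)]) ++ l' ++ invRev (w ++ [(a, e)]) := by
        rw [inv_mk, mul_mk, mul_mk] at h
        have := congrArg toWord h
        rw [toWord_mk, toWord_mk, hl.isReduced.reduce_eq, hred.reduce_eq] at this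
        exact this.symm
      have hc := hl.2
      obtain ⟨⟨b, f⟩, s, hs⟩ : ∃ b s, w ++ [(a, e)] = b :: s := by
        cases w with
        | nil => exact ⟨_, _, rfl⟩
        | cons b s => exact ⟨_, _, rfl⟩
      have hform : (b, f) :: s ++ l' ++ invRev ((b, f) :: s)
          = (b, f) :: (s ++ l' ++ invRev s) ++ [(b, !f)] := by simp [invRev]
      rw [hE, hs, hform, List.getLast?_concat] at hc
      have := hc (b, !f) (by simp) (b, f) (by simp) rfl
      simp at this

lemma center_free [DecidableEq X] (z : FreeGroup X) (hz : ∀ g, g * z = z * g) (x y : X) (hxy : x ≠ y) :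
    z = 1 := by
  by_contra hne
  have hw : z.toWord ≠ [] := by simpa using hne
  obtain ⟨⟨a, e⟩, s, hs⟩ := List.exists_cons_of_ne_nil hw
  obtain ⟨b, hb⟩ : ∃ b, b ≠ a := by
    by_cases h : x = a
    · exact ⟨y, fun h' => hxy (h.trans h'.symm)⟩
    · exact ⟨x, h⟩
  have hr : IsReduced z.toWord := isReduced_toWord
  -- conjugate by `of b`
  have h1 : of b * z * (of b)⁻¹ = z := by rw [hz]; group
  have h2 : (of b * z).toWord = (b, true) :: z.toWord := by
    rw [toWord_mul, toWord_of]
    apply IsReduced.reduce_eq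
    rw [hs] at hr ⊢
    simp only [List.singleton_append]
    rw [isReduced_cons_cons]
    exact ⟨fun h => absurd h hb, hr⟩
  have h3 : (z * of b).toWord.Sublist (z.toWord ++ [(b, true)]) := by
    have := toWord_mul_sublist z (of b)
    rwa [toWord_of] at this
  rw [← hz, h2] at h3
  have h4 := h3.eq_of_length (by simp)
  rw [hs] at h4
  simp at h4
  exact hb h4.1.1

lemma centralizer_cyclic (n : FreeGroup X) (hn : n ≠ 1) :
    ∃ r : FreeGroup X, Commute r n ∧ ∀ g, Commute g n → ∃ i : ℤ, g = r ^ i := by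
  classical
  let C := Subgroup.centralizer ({n} : Set (FreeGroup X))
  have hC : ∀ g, g ∈ C ↔ Commute g n := by
    intro g
    rw [Subgroup.mem_centralizer_singleton_iff]; rfl
  have : IsFreeGroup C := inferInstance
  let e := IsFreeGroup.toFreeGroup C
  have hnC : n ∈ C := (hC n).2 (Commute.refl n)
  have hne : e ⟨n, hnC⟩ ≠ 1 := by
    intro h
    rw [map_eq_one_iff e e.injective] at h
    exact hn (congrArg Subtype.val h)
  have hz : ∀ g, g * e ⟨n, hnC⟩ = e ⟨n, hnC⟩ * g := by
    intro g
    obtain ⟨c, rfl⟩ := e.surjective g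
    rw [← _root_.map_mul, ← _root_.map_mul]
    congr 1
    exact Subtype.ext ((hC c).1 c.2)
  have hsub : Subsingleton (IsFreeGroup.Generators C) := by
    constructor
    intro x y
    by_contra hxy
    exact hne (center_free _ hz x y hxy)
  have hnon : Nonempty (IsFreeGroup.Generators C) := by
    by_contra h
    rw [not_nonempty_iff] at h
    exact hne (Subsingleton.elim _ _)
  obtain ⟨x⟩ := hnon
  have : Unique (IsFreeGroup.Generators C) := ⟨⟨x⟩, fun y => Subsingleton.elim _ _⟩
  obtain ⟨r, hr⟩ := (inferInstance : IsCyclic (FreeGroup (IsFreeGroup.Generators C))).exists_generator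
  refine ⟨(e.symm r : C), (hC _).1 (e.symm r).2, ?_⟩
  intro g hg
  obtain ⟨i, hi⟩ := hr (e ⟨g, (hC g).2 hg⟩)
  refine ⟨i, ?_⟩
  have : e.symm (r ^ i) = ⟨g, (hC g).2 hg⟩ := by
    rw [← e.symm_apply_apply ⟨g, (hC g).2 hg⟩]; congr 1
  rw [map_zpow] at this
  simpa using (congrArg Subtype.val this).symm

lemma aut_fix (n : FreeGroup X) (hn : n ≠ 1) (f : MulAut (FreeGroup X)) (hf : f n = n)
    (g : FreeGroup X) (hg : Commute g n) : f g = g := by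
  obtain ⟨r, hr, hr'⟩ := centralizer_cyclic n hn
  obtain ⟨m, hm⟩ := hr' n (Commute.refl n)
  have hm0 : m ≠ 0 := by rintro rfl; simp at hm; exact hn hm
  have h1 : (f r) ^ m = r ^ m := by rw [← map_zpow, ← hm, hf]
  have h2 : f r = r := zpow_left_injective hm0 h1
  obtain ⟨i, rfl⟩ := hr' g hg
  rw [map_zpow, h2]

lemma comm_of_comm (n : FreeGroup X) (hn : n ≠ 1) (g h : FreeGroup X)
    (hg : Commute g n) (hh : Commute h n) : Commute g h := by
  obtain ⟨r, hr, hr'⟩ := centralizer_cyclic n hn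
  obtain ⟨i, rfl⟩ := hr' g hg
  obtain ⟨j, rfl⟩ := hr' h hh
  exact (Commute.refl r).zpow_zpow i j

lemma mem_zpowers_of_letters (x : X) (l : List (X × Bool)) (h : ∀ p ∈ l, p.1 = x) :
    mk l ∈ Subgroup.zpowers (of x) := by
  induction l with
  | nil => rw [← one_eq_mk]; exact one_mem _
  | cons p l ih =>
    rw [show p :: l = [p] ++ l from rfl, ← mul_mk]
    refine mul_mem ?_ (ih fun q hq => h q (by simp [hq]))
    obtain ⟨y, e⟩ := p
    have : y = x := h (y, e) (by simp)
    subst this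
    cases e
    · have : (mk [(y, false)] : FreeGroup X) = (of y)⁻¹ := by simp [of, inv_mk, invRev]
      rw [this]; exact inv_mem (Subgroup.mem_zpowers _)
    · exact Subgroup.mem_zpowers (of y)

end Free

section Act
variable {X K : Type*} [Group K] [MulAction K X]

/-- Action of `K` on the free group on a `K`-set. -/
def act (K X : Type*) [Group K] [MulAction K X] : K →* MulAut (FreeGroup X) where
  toFun k := freeGroupCongr (MulAction.toPerm k)
  map_one' := by
    ext x
    have : (MulAction.toPerm (1 : K) : X → X) = id := by ext; simp
    simp [this]
  map_mul' a b := by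
    ext x
    have : (MulAction.toPerm (a * b) : X → X) = MulAction.toPerm a ∘ MulAction.toPerm b := by
      ext; simp [mul_smul]
    simp [this, MulAut.mul_apply, map.comp]

lemma act_mk (k : K) (l : List (X × Bool)) :
    act K X k (mk l) = mk (l.map fun p => (k • p.1, p.2)) := rfl

lemma act_of (k : K) (x : X) : act K X k (of x) = of (k • x) := rfl

lemma red_map (k : K) (l : List (X × Bool)) (h : IsReduced l) :
    IsReduced (l.map fun p => (k • p.1, p.2)) := by
  unfold FreeGroup.IsReduced at *
  rw [List.isChain_map]
  refine h.imp ?_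
  intro a b hab h'
  exact hab (MulAction.injective k h')

lemma cyc_map (k : K) (l : List (X × Bool)) (h : IsCyclicallyReduced l) :
    IsCyclicallyReduced (l.map fun p => (k • p.1, p.2)) := by
  refine ⟨red_map k l h.1, ?_⟩
  intro a ha b hb hab
  simp only [List.getLast?_map, List.head?_map, Option.mem_def, Option.map_eq_some_iff] at ha hb
  obtain ⟨a, ha, rfl⟩ := ha
  obtain ⟨b, hb, rfl⟩ := hb
  exact h.2 a ha b hb (MulAction.injective k hab)

lemma act_fix [DecidableEq X] (k : K) (m : FreeGroup X) (h : act K X k m = m) :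
    ∀ p ∈ m.toWord, k • p.1 = p.1 := by
  have h1 : act K X k (mk m.toWord) = mk m.toWord := by rw [mk_toWord, h]
  rw [act_mk] at h1
  have := congrArg toWord h1
  rw [toWord_mk, toWord_mk, (red_map k _ isReduced_toWord).reduce_eq, reduce_toWord] at this
  have h2 : m.toWord.map (fun p => (k • p.1, p.2)) = m.toWord.map id := by simpa using this
  rw [List.map_inj_left] at h2
  intro p hp
  exact congrArg Prod.fst (h2 p hp)


open SemidirectProduct
open scoped commutatorElement

lemma core (A B : Subgroup (FreeGroup X ⋊[act K X] K))
    (hA : ∀ a ∈ A, a.right = 1) (a1 a2 : FreeGroup X ⋊[act K X] K) (h1 : a1 ∈ A) (h2 : a2 ∈ A)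
    (h12 : a1 * a2 ≠ a2 * a1) (hAB : ∀ a ∈ A, ∀ b ∈ B, a * b = b * a) :
    ∃ (y : FreeGroup X) (x1 x2 : X), x1 ≠ x2 ∧
      ∀ b ∈ ⁅⁅B, B⁆, ⁅B, B⁆⁆, ∃ k : K, inl y * b * (inl y)⁻¹ = inr k ∧
        k • x1 = x1 ∧ k • x2 = x2 := by
  classical
  have hinl : ∀ a ∈ A, a = inl a.left := by
    intro a ha
    ext
    · simp
    · simp [hA a ha]
  set n := a1.left with hn
  have hn1 : n ≠ 1 := by
    intro h
    apply h12
    rw [hinl a1 h1, ← hn, h]; simp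
  let c : FreeGroup X := mk (reduceCyclically.conjugator n.toWord)
  let l := reduceCyclically n.toWord
  have hl : IsCyclicallyReduced l := reduceCyclically.isCyclicallyReduced isReduced_toWord
  have hnc : n = c * mk l * c⁻¹ := by
    have := congrArg mk (reduceCyclically.conj_conjugator_reduceCyclically n.toWord)
    rw [mk_toWord, ← mul_mk, ← mul_mk, ← inv_mk] at this
    exact this.symm
  have hl1 : (mk l : FreeGroup X) ≠ 1 := by
    intro h
    apply hn1
    rw [hnc, h]; group
  let y := c⁻¹
  let cj : (FreeGroup X ⋊[act K X] K) →* (FreeGroup X ⋊[act K X] K) :=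
    (MulAut.conj (inl y)).toMonoidHom
  have hcj : ∀ p, cj p = inl y * p * (inl y)⁻¹ := fun p => rfl
  have hcn : cj a1 = inl (mk l) := by
    rw [hcj, hinl a1 h1, ← hn, hnc, ← _root_.map_inv, ← _root_.map_mul, ← _root_.map_mul]
    congr 1
    simp only [y]
    group
  let n0 : FreeGroup X := mk l
  let E : Subgroup (FreeGroup X ⋊[act K X] K) :=
    { carrier := {p | act K X p.right n0 = n0 ∧ Commute p.left n0}
      one_mem' := by simp
      mul_mem' := by
        rintro p q ⟨hp, hp'⟩ ⟨hq, hq'⟩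
        refine ⟨by simp [hp, hq], ?_⟩
        rw [mul_left, aut_fix n0 hl1 _ hp _ hq']
        exact hp'.mul_left hq'
      inv_mem' := by
        rintro p ⟨hp, hp'⟩
        have hpi : act K X p.right⁻¹ n0 = n0 := by
          nth_rewrite 1 [← hp]
          rw [← MulAut.mul_apply, ← _root_.map_mul]; simp
        refine ⟨by simpa using hpi, ?_⟩
        rw [inv_left, aut_fix n0 hl1 _ hpi _ hp'.inv_left]
        exact hp'.inv_left }
  -- first derived subgroup
  have hB : ∀ b ∈ B, cj b * inl n0 = inl n0 * cj b := by
    intro b hb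
    rw [← hcn, ← _root_.map_mul, ← _root_.map_mul, hAB a1 h1 b hb]
  have hleft : ∀ p : FreeGroup X ⋊[act K X] K, p * inl n0 = inl n0 * p →
      p.left * act K X p.right n0 * p.left⁻¹ = n0 := by
    intro p hp
    have := congrArg SemidirectProduct.left hp
    simp only [mul_left, left_inl, right_inl, _root_.map_one, MulAut.one_apply] at this
    rw [this]; group
  have hrot : ∀ p : FreeGroup X ⋊[act K X] K, p * inl n0 = inl n0 * p →
      ∃ i : ℕ, l.map (fun q => (p.right • q.1, q.2)) = l.rotate i := by
    intro p hp
    have h := hleft p hp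
    rw [act_mk] at h
    have h' := conj_rot p.left.toWord l _ isReduced_toWord hl (cyc_map p.right l hl)
      (by rw [mk_toWord]; exact h)
    obtain ⟨i, hi⟩ := h'.symm
    exact ⟨i, hi.symm⟩
  have hB1 : ⁅B, B⁆ ≤ E.comap cj := by
    rw [Subgroup.commutator_le]
    intro p hp q hq
    obtain ⟨i, hi⟩ := hrot _ (hB p⁻¹ (inv_mem hp))
    obtain ⟨j, hj⟩ := hrot _ (hB q⁻¹ (inv_mem hq))
    have hpq : act K X ((cj p⁻¹).right * (cj q⁻¹).right) n0
        = act K X ((cj q⁻¹).right * (cj p⁻¹).right) n0 := by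
      rw [_root_.map_mul, _root_.map_mul, MulAut.mul_apply, MulAut.mul_apply]
      simp only [n0, act_mk]
      rw [hi, hj, List.map_rotate, List.map_rotate, hi, hj, List.rotate_rotate, List.rotate_rotate,
        add_comm]
    have hfix : act K X (cj ⁅p, q⁆).right n0 = n0 := by
      have e : (cj ⁅p, q⁆).right = ((cj p).right * (cj q).right) *
          ((cj p⁻¹).right * (cj q⁻¹).right) := by
        rw [map_commutatorElement, commutatorElement_def]
        simp only [mul_right, inv_right, _root_.map_inv]
        group
      rw [e, _root_.map_mul, MulAut.mul_apply, hpq, ← MulAut.mul_apply, ← _root_.map_mul]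
      simp only [inv_right, _root_.map_inv]
      have : (cj p).right * (cj q).right * ((cj q).right⁻¹ * (cj p).right⁻¹) = 1 := by group
      rw [this]; simp
    refine ⟨hfix, ?_⟩
    have hcm : cj ⁅p, q⁆ * inl n0 = inl n0 * cj ⁅p, q⁆ := by
      have h3 : Commute (cj p) (inl n0) := hB p hp
      have h4 : Commute (cj q) (inl n0) := hB q hq
      rw [map_commutatorElement, commutatorElement_def]
      exact ((h3.mul_left h4).mul_left h3.inv_left).mul_left h4.inv_left
    have := hleft _ hcm
    rw [hfix] at this
    exact mul_inv_eq_iff_eq_mul.1 this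
  have hB2 : ∀ b ∈ ⁅⁅B, B⁆, ⁅B, B⁆⁆, cj b ∈ (inr : K →* FreeGroup X ⋊[act K X] K).range := by
    change ⁅⁅B, B⁆, ⁅B, B⁆⁆ ≤ (inr : K →* FreeGroup X ⋊[act K X] K).range.comap cj
    rw [Subgroup.commutator_le]
    intro p hp q hq
    have hp := hB1 hp
    have hq := hB1 hq
    rw [Subgroup.mem_comap] at hp hq ⊢
    rw [map_commutatorElement]
    generalize cj p = p at *
    generalize cj q = q at *
    obtain ⟨hp1, hp2⟩ := hp
    obtain ⟨hq1, hq2⟩ := hq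
    have e1 : p = inl p.left * inr p.right := (inl_left_mul_inr_right p).symm
    have e2 : q = inl q.left * inr q.right := (inl_left_mul_inr_right q).symm
    refine ⟨⁅p.right, q.right⁆, ?_⟩
    have hc : ∀ (k : K) (m : FreeGroup X), act K X k n0 = n0 → Commute m n0 →
        Commute (inr k : FreeGroup X ⋊[act K X] K) (inl m) := by
      intro k m hk hm
      have h3 := inl_aut (φ := act K X) k m
      rw [aut_fix n0 hl1 _ hk _ hm, _root_.map_inv] at h3
      exact (mul_inv_eq_iff_eq_mul.1 h3.symm)
    have c1 := hc p.right p.left hp1 hp2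
    have c2 := hc p.right q.left hp1 hq2
    have c3 := hc q.right p.left hq1 hp2
    have c4 := hc q.right q.left hq1 hq2
    have c5 : Commute (inl p.left : FreeGroup X ⋊[act K X] K) (inl q.left) :=
      (comm_of_comm n0 hl1 _ _ hp2 hq2).map inl
    rw [e1, e2]
    simp only [map_commutatorElement, mul_right, right_inl, right_inr, one_mul]
    generalize (inl p.left : FreeGroup X ⋊[act K X] K) = P at *
    generalize (inl q.left : FreeGroup X ⋊[act K X] K) = Q at *
    generalize (inr p.right : FreeGroup X ⋊[act K X] K) = S at *
    generalize (inr q.right : FreeGroup X ⋊[act K X] K) = T at *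
    have f1 : P * S * (Q * T) = (P * Q) * (S * T) := by
      rw [mul_assoc, ← mul_assoc S, c2.eq]; simp only [mul_assoc]
    have f2 : Q * T * (P * S) = (P * Q) * (T * S) := by
      rw [mul_assoc, ← mul_assoc T, c3.eq, c5.eq]; simp only [mul_assoc]
    have f3 : Commute (P * Q) (S * T * (T * S)⁻¹) := by
      have g1 : Commute (P * Q) S := c1.symm.mul_left c2.symm
      have g2 : Commute (P * Q) T := c3.symm.mul_left c4.symm
      exact (g1.mul_right g2).mul_right (g2.mul_right g1).inv_right
    have f4 : ∀ u v : FreeGroup X ⋊[act K X] K, ⁅u, v⁆ = u * v * (v * u)⁻¹ := by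
      intro u v; rw [commutatorElement_def]; group
    rw [f4, f4, f1, f2, mul_inv_rev (P * Q), ← mul_assoc, mul_assoc (P * Q), f3.eq]
    group
  obtain ⟨x1, x2, hx1, hx2, hne⟩ : ∃ x1 x2 : X,
      (∃ a ∈ A, ∃ q ∈ (cj a).left.toWord, q.1 = x1) ∧
      (∃ a ∈ A, ∃ q ∈ (cj a).left.toWord, q.1 = x2) ∧ x1 ≠ x2 := by
    by_contra hcon
    push Not at hcon
    have hlne : (cj a1).left.toWord ≠ [] := by
      rw [hcn, left_inl, Ne, toWord_eq_nil_iff]; exact hl1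
    obtain ⟨q, s, hs⟩ := List.exists_cons_of_ne_nil hlne
    have hall : ∀ a ∈ A, (cj a).left ∈ Subgroup.zpowers (of q.1) := by
      intro a ha
      rw [← mk_toWord (x := (cj a).left)]
      apply mem_zpowers_of_letters
      intro r hr
      exact hcon r.1 q.1 ⟨a, ha, r, hr, rfl⟩ ⟨a1, h1, q, by simp [hs], rfl⟩
    have hcl : ∀ a ∈ A, cj a = inl (cj a).left := by
      intro a ha
      rw [hcj, hinl a ha, ← _root_.map_inv, ← _root_.map_mul, ← _root_.map_mul]
      simp
    obtain ⟨i, hi⟩ := hall a1 h1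
    obtain ⟨j, hj⟩ := hall a2 h2
    have : cj (a1 * a2) = cj (a2 * a1) := by
      rw [_root_.map_mul, _root_.map_mul, hcl a1 h1, hcl a2 h2, ← hi, ← hj]
      exact (((Commute.refl (of q.1)).zpow_zpow i j).map inl)
    exact h12 ((MulAut.conj (inl y)).injective this)
  refine ⟨y, x1, x2, hne, ?_⟩
  intro b hb
  obtain ⟨k, hk⟩ := hB2 b hb
  have hBB : ⁅⁅B, B⁆, ⁅B, B⁆⁆ ≤ B := by
    have : ⁅B, B⁆ ≤ B := Subgroup.commutator_le_self B
    exact (Subgroup.commutator_mono this this).trans this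
  have hfix : ∀ x, (∃ a ∈ A, ∃ q ∈ (cj a).left.toWord, q.1 = x) → k • x = x := by
    rintro x ⟨a, ha, q, hq, rfl⟩
    refine act_fix k (cj a).left ?_ q hq
    have hcl : cj a = inl (cj a).left := by
      rw [hcj, hinl a ha, ← _root_.map_inv, ← _root_.map_mul, ← _root_.map_mul]
      simp
    have h3 : cj a * cj b = cj b * cj a := by
      rw [← _root_.map_mul, ← _root_.map_mul, hAB a ha b (hBB hb)]
    rw [← hk, hcl] at h3
    have := congrArg SemidirectProduct.left h3
    simpa using this.symm
  exact ⟨k, hk.symm, hfix x1 hx1, hfix x2 hx2⟩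

end Act
end Kamb

namespace Kamb
open SemidirectProduct
section R
variable {V : Type*} {Γ : SimpleGraph V}

/-- generator -/
def gen (Γ : SimpleGraph V) (v : V) : RAAG Γ := PresentedGroup.of v

lemma gen_comm {u v : V} (h : Γ.Adj u v) : Commute (gen Γ u) (gen Γ v) := by
  have : PresentedGroup.mk (raagRels Γ) (FreeGroup.of u * FreeGroup.of v * (FreeGroup.of u)⁻¹ *
      (FreeGroup.of v)⁻¹) = 1 := PresentedGroup.one_of_mem ⟨u, v, h, rfl⟩
  simp only [map_mul, map_inv] at this
  have h2 : gen Γ u * gen Γ v * (gen Γ u)⁻¹ * (gen Γ v)⁻¹ = 1 := this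
  rw [mul_inv_eq_one, mul_inv_eq_iff_eq_mul] at h2
  exact h2

/-- universal property -/
def rlift {H : Type*} [Group H] (f : V → H) (hf : ∀ u v, Γ.Adj u v → Commute (f u) (f v)) :
    RAAG Γ →* H :=
  PresentedGroup.toGroup (f := f) (by
    rintro r ⟨u, v, h, rfl⟩
    simp only [map_mul, map_inv, FreeGroup.lift_apply_of]
    rw [(hf u v h).eq]; group)

@[simp] lemma rlift_gen {H : Type*} [Group H] (f : V → H)
    (hf : ∀ u v, Γ.Adj u v → Commute (f u) (f v)) (v : V) : rlift f hf (gen Γ v) = f v :=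
  PresentedGroup.toGroup.of _

/-- standard parabolic subgroup -/
def par (Γ : SimpleGraph V) (S : Set V) : Subgroup (RAAG Γ) := Subgroup.closure (gen Γ '' S)

lemma gen_mem {S : Set V} {v : V} (h : v ∈ S) : gen Γ v ∈ par Γ S :=
  Subgroup.subset_closure ⟨v, h, rfl⟩

lemma par_mono {S T : Set V} (h : S ⊆ T) : par Γ S ≤ par Γ T :=
  Subgroup.closure_mono (Set.image_mono h)

lemma par_univ : par Γ Set.univ = ⊤ := by
  rw [par, Set.image_univ]
  exact PresentedGroup.closure_range_of _

lemma hom_ext_gen {H : Type*} [Group H] {f g : RAAG Γ →* H} (h : ∀ v, f (gen Γ v) = g (gen Γ v)) :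
    f = g := PresentedGroup.ext h

lemma eq_on_par {H : Type*} [Group H] {f g : RAAG Γ →* H} {S : Set V}
    (h : ∀ v ∈ S, f (gen Γ v) = g (gen Γ v)) {x : RAAG Γ} (hx : x ∈ par Γ S) : f x = g x := by
  refine MonoidHom.eqOn_closure (f := f) (g := g) ?_ hx
  rintro _ ⟨v, hv, rfl⟩
  exact h v hv

lemma map_par_le {H : Type*} [Group H] {f : RAAG Γ →* H} {S : Set V} {W : Subgroup H}
    (h : ∀ v ∈ S, f (gen Γ v) ∈ W) {x : RAAG Γ} (hx : x ∈ par Γ S) : f x ∈ W := by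
  have : par Γ S ≤ W.comap f := by
    rw [par, Subgroup.closure_le]
    rintro _ ⟨v, hv, rfl⟩
    exact h v hv
  exact this hx

open Classical in
/-- retraction -/
noncomputable def ret (Γ : SimpleGraph V) (S : Set V) : RAAG Γ →* RAAG Γ :=
  rlift (fun v => if v ∈ S then gen Γ v else 1) (by
    intro u v h
    by_cases h1 : u ∈ S <;> by_cases h2 : v ∈ S <;> simp [h1, h2, gen_comm h])

lemma ret_gen_mem {S : Set V} {v : V} (h : v ∈ S) : ret Γ S (gen Γ v) = gen Γ v := by
  simp [ret, h]

lemma ret_gen_notMem {S : Set V} {v : V} (h : v ∉ S) : ret Γ S (gen Γ v) = 1 := by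
  simp [ret, h]

lemma ret_par {S : Set V} {x : RAAG Γ} (hx : x ∈ par Γ S) : ret Γ S x = x :=
  eq_on_par (g := MonoidHom.id _) (fun v hv => ret_gen_mem hv) hx

lemma ret_mem_inter {S T : Set V} {x : RAAG Γ} (hx : x ∈ par Γ T) : ret Γ S x ∈ par Γ (S ∩ T) := by
  refine map_par_le (f := ret Γ S) ?_ hx
  intro v hv
  by_cases h : v ∈ S
  · rw [ret_gen_mem h]; exact gen_mem ⟨h, hv⟩
  · rw [ret_gen_notMem h]; exact one_mem _

lemma ret_mem {S : Set V} (x : RAAG Γ) : ret Γ S x ∈ par Γ S := by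
  have : x ∈ par Γ Set.univ := by rw [par_univ]; trivial
  simpa using ret_mem_inter (S := S) this

/-- a parabolic subgroup on a clique is commutative -/
lemma par_comm {S : Set V} (h : ∀ u ∈ S, ∀ v ∈ S, u ≠ v → Γ.Adj u v) {x y : RAAG Γ}
    (hx : x ∈ par Γ S) (hy : y ∈ par Γ S) : x * y = y * x := by
  have h1 : ∀ u ∈ S, ∀ y ∈ par Γ S, Commute (gen Γ u) y := by
    intro u hu y hy
    have : y ∈ Subgroup.centralizer {gen Γ u} := by
      refine map_par_le (f := MonoidHom.id _) ?_ hy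
      intro v hv
      rw [Subgroup.mem_centralizer_singleton_iff]
      by_cases huv : u = v
      · subst huv; rfl
      · exact (gen_comm (h u hu v hv huv)).symm
    rw [Subgroup.mem_centralizer_singleton_iff] at this
    exact this.symm
  have : x ∈ Subgroup.centralizer {y} := by
    refine map_par_le (f := MonoidHom.id _) ?_ hx
    intro v hv
    rw [Subgroup.mem_centralizer_singleton_iff]
    exact h1 v hv y hy
  rw [Subgroup.mem_centralizer_singleton_iff] at this
  exact this

lemma exists_nonadj {S : Set V} {x y : RAAG Γ}
    (hx : x ∈ par Γ S) (hy : y ∈ par Γ S) (hxy : x * y ≠ y * x) :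
    ∃ u ∈ S, ∃ v ∈ S, u ≠ v ∧ ¬ Γ.Adj u v := by
  by_contra h
  push Not at h
  exact hxy (par_comm h hx hy)

/-- coset space -/
abbrev Cos (Γ : SimpleGraph V) (R : Set V) (v : V) :=
  (par Γ R) ⧸ ((par Γ (R ∩ Γ.neighborSet v)).subgroupOf (par Γ R))

abbrev SD (Γ : SimpleGraph V) (R : Set V) (v : V) :=
  FreeGroup (Cos Γ R v) ⋊[act (par Γ R) (Cos Γ R v)] (par Γ R)

lemma smul_cos (R : Set V) (v : V) (k g : par Γ R) :
    k • (QuotientGroup.mk g : Cos Γ R v) = QuotientGroup.mk g ↔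
      (g : RAAG Γ)⁻¹ * k * g ∈ par Γ (R ∩ Γ.neighborSet v) := by
  rw [MulAction.Quotient.smul_mk, eq_comm, QuotientGroup.eq, Subgroup.mem_subgroupOf]
  simp [mul_assoc]

open Classical in
noncomputable def thetaFun (Γ : SimpleGraph V) (R : Set V) (v : V) (w : V) : SD Γ R v :=
  if h : w ∈ R then inr ⟨gen Γ w, gen_mem h⟩
  else if w = v then inl (FreeGroup.of (QuotientGroup.mk 1)) else 1

lemma thetaFun_comm (R : Set V) (v : V) (hv : v ∉ R) (w : V) (h : Γ.Adj v w) :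
    Commute (thetaFun Γ R v w) (thetaFun Γ R v v) := by
  have hwv : w ≠ v := h.ne'
  by_cases hw : w ∈ R
  · have hfix : (⟨gen Γ w, gen_mem hw⟩ : par Γ R) • (QuotientGroup.mk 1 : Cos Γ R v)
      = QuotientGroup.mk 1 := by
      rw [smul_cos]; simpa using gen_mem (Γ := Γ) (S := R ∩ Γ.neighborSet v) ⟨hw, h⟩
    simp only [thetaFun, hw, hv, dif_pos, dif_neg, not_false_eq_true, if_true]
    have h3 := inl_aut (φ := act (par Γ R) (Cos Γ R v)) ⟨gen Γ w, gen_mem hw⟩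
      (FreeGroup.of (QuotientGroup.mk 1))
    rw [act_of, hfix, map_inv] at h3
    exact (mul_inv_eq_iff_eq_mul.1 h3.symm)
  · simp [thetaFun, hw, hwv]

noncomputable def theta (Γ : SimpleGraph V) (R : Set V) (v : V) (hv : v ∉ R) :
    RAAG Γ →* SD Γ R v :=
  rlift (thetaFun Γ R v) (by
    intro a b hab
    by_cases ha : a = v
    · subst ha; exact (thetaFun_comm R a hv b hab).symm
    by_cases hb : b = v
    · subst hb; exact (thetaFun_comm R b hv a hab.symm)
    by_cases ha' : a ∈ R <;> by_cases hb' : b ∈ R <;> simp [thetaFun, ha, hb, ha', hb']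
    refine Commute.map (f := inr) ?_
    exact Subtype.ext (gen_comm hab))

/-- conjugate of `v` attached to a coset -/
noncomputable def cosConj (Γ : SimpleGraph V) (R : Set V) (v : V) : Cos Γ R v → RAAG Γ :=
  Quotient.lift (fun g : par Γ R => (g : RAAG Γ) * gen Γ v * (g : RAAG Γ)⁻¹) (by
    intro a b hab
    have hab := QuotientGroup.leftRel_apply.1 hab
    rw [Subgroup.mem_subgroupOf] at hab
    have hc : ((a⁻¹ * b : par Γ R) : RAAG Γ) ∈ Subgroup.centralizer {gen Γ v} := by
      refine map_par_le (f := MonoidHom.id _) ?_ hab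
      intro w hw
      rw [Subgroup.mem_centralizer_singleton_iff]
      exact (gen_comm hw.2).symm
    rw [Subgroup.mem_centralizer_singleton_iff] at hc
    have e : (b : RAAG Γ) = a * ((a⁻¹ * b : par Γ R) : RAAG Γ) := by simp
    rw [e, mul_assoc (a : RAAG Γ) _ (gen Γ v), hc]
    group)

lemma cosConj_mk (R : Set V) (v : V) (g : par Γ R) :
    cosConj Γ R v (QuotientGroup.mk g) = (g : RAAG Γ) * gen Γ v * (g : RAAG Γ)⁻¹ := rfl

noncomputable def thetaInv (Γ : SimpleGraph V) (R : Set V) (v : V) : SD Γ R v →* RAAG Γ :=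
  SemidirectProduct.lift (FreeGroup.lift (cosConj Γ R v)) (par Γ R).subtype (by
    intro k
    apply FreeGroup.ext_hom
    intro x
    obtain ⟨g, rfl⟩ := QuotientGroup.mk_surjective x
    simp only [MonoidHom.comp_apply, MulEquiv.coe_toMonoidHom, act_of, FreeGroup.lift_apply_of,
      MulAction.Quotient.smul_mk, cosConj_mk, MulAut.conj_apply]
    simp [mul_assoc])

lemma theta_gen_mem {R : Set V} {v : V} (hv : v ∉ R) {w : V} (hw : w ∈ R) :
    theta Γ R v hv (gen Γ w) = inr ⟨gen Γ w, gen_mem hw⟩ := by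
  simp [theta, thetaFun, hw]

lemma theta_gen_self {R : Set V} {v : V} (hv : v ∉ R)  :
    theta Γ R v hv (gen Γ v) = inl (FreeGroup.of (QuotientGroup.mk 1)) := by
  simp [theta, thetaFun, hv]

lemma theta_gen_other {R : Set V} {v : V} (hv : v ∉ R) {w : V} (hw : w ∉ R) (hwv : w ≠ v) :
    theta Γ R v hv (gen Γ w) = 1 := by
  simp [theta, thetaFun, hw, hwv]

lemma thetaInv_theta {R : Set V} {v : V} (hv : v ∉ R) {x : RAAG Γ} (hx : x ∈ par Γ (insert v R)) :
    thetaInv Γ R v (theta Γ R v hv x) = x := by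
  refine eq_on_par (f := (thetaInv Γ R v).comp (theta Γ R v hv)) (g := MonoidHom.id _) ?_ hx
  intro w hw
  rcases hw with rfl | hw
  · simp [theta_gen_self, thetaInv, cosConj_mk]
  · simp [theta_gen_mem hv hw, thetaInv]

lemma theta_inj {R : Set V} {v : V} (hv : v ∉ R) {x y : RAAG Γ} (hx : x ∈ par Γ (insert v R))
    (hy : y ∈ par Γ (insert v R)) (h : theta Γ R v hv x = theta Γ R v hv y) : x = y := by
  rw [← thetaInv_theta hv hx, ← thetaInv_theta hv hy, h]

lemma theta_right {R : Set V} {v : V} (hv : v ∉ R) (x : RAAG Γ) :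
    ((theta Γ R v hv x).right : RAAG Γ) = ret Γ R x := by
  have : ((par Γ R).subtype.comp rightHom).comp (theta Γ R v hv) = ret Γ R := by
    apply hom_ext_gen
    intro w
    by_cases hw : w ∈ R
    · simp [theta_gen_mem hv hw, ret_gen_mem hw]
    · rw [ret_gen_notMem hw]
      by_cases hwv : w = v
      · subst hwv; simp [theta_gen_self]
      · simp [theta_gen_other hv hw hwv]
  exact DFunLike.congr_fun this x

lemma theta_par {R : Set V} {v : V} (hv : v ∉ R) (x : par Γ R) :
    theta Γ R v hv x = inr x := by
  have h : theta Γ R v hv x = (inr.comp ((ret Γ R).codRestrict (par Γ R) ret_mem)) (x : RAAG Γ) := by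
    refine eq_on_par ?_ x.2
    intro w hw
    rw [theta_gen_mem hv hw]
    simp only [MonoidHom.comp_apply]
    congr 1
    exact Subtype.ext (ret_gen_mem hw).symm
  rw [h]
  simp only [MonoidHom.comp_apply]
  congr 1
  exact Subtype.ext (ret_par x.2)

lemma lemma2 (T : Set V) (S : Finset V) : T ⊆ S → ∀ (g b d : RAAG Γ), g ∈ par Γ S → g ∉ par Γ T →
    b ∈ par Γ T → d ∈ par Γ T → b * d ≠ d * b → g⁻¹ * b * g ∈ par Γ T → g⁻¹ * d * g ∈ par Γ T →
    ∃ u ∈ S, u ∉ T ∧ ∃ y ∈ T, ∃ w ∈ T, Γ.Adj u y ∧ Γ.Adj u w ∧ y ≠ w ∧ ¬ Γ.Adj y w := by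
  classical
  induction S using Finset.strongInduction with
  | H S ih =>
  intro hTS g b d hg hgT hb hd hbd hb' hd'
  obtain ⟨u, huS, huT⟩ : ∃ u ∈ S, u ∉ T := by
    by_contra h
    push Not at h
    exact hgT (par_mono (fun x hx => h x hx) hg)
  let R := S.erase u
  have hTR : T ⊆ (R : Set V) := by
    intro x hx
    have : x ≠ u := by rintro rfl; exact huT hx
    simp [R, this]; exact hTS hx
  by_cases hr : ret Γ R g ∈ par Γ T
  swap
  · have fixT : ∀ x ∈ par Γ T, ret Γ R x = x := fun x hx => ret_par (par_mono hTR hx)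
    obtain ⟨u', hu', h⟩ := ih R (Finset.erase_ssubset huS) hTR (ret Γ R g) b d (ret_mem _) hr hb hd hbd
      (by
        have := fixT _ hb'
        rw [map_mul, map_mul, map_inv, fixT b hb] at this
        rw [this]; exact hb')
      (by
        have := fixT _ hd'
        rw [map_mul, map_mul, map_inv, fixT d hd] at this
        rw [this]; exact hd')
    exact ⟨u', Finset.mem_of_mem_erase hu', h⟩
  · have fixT : ∀ x ∈ par Γ T, ret Γ R x = x := fun x hx => ret_par (par_mono hTR hx)
    have huR : u ∉ (R : Set V) := by simp [R]
    have hins : insert u (R : Set V) = S := by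
      rw [← Finset.coe_insert, Finset.insert_erase huS]
    set h := ret Γ R g with hh
    let n := g * h⁻¹
    have hhR : h ∈ par Γ R := ret_mem _
    have hnS : n ∈ par Γ (insert u (R : Set V)) := by
      rw [hins]
      exact mul_mem hg (inv_mem (par_mono (by simp [R]) hhR))
    have hn1 : n ≠ 1 := by
      intro h1
      apply hgT
      rw [mul_inv_eq_one.1 h1]; exact hr
    have hrn : ret Γ R n = 1 := by
      simp only [n, map_mul, map_inv]
      rw [← hh, ret_par hhR]; group
    have hcomm : ∀ x ∈ par Γ T, g⁻¹ * x * g ∈ par Γ T → x * n = n * x := by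
      intro x hx hx'
      have := fixT _ hx'
      rw [map_mul, map_mul, map_inv, fixT x hx, ← hh] at this
      -- h⁻¹ x h = g⁻¹ x g
      have e : g * (h⁻¹ * x * h) * h⁻¹ = g * (g⁻¹ * x * g) * h⁻¹ := by rw [this]
      simp only [n]
      calc x * (g * h⁻¹) = g * (g⁻¹ * x * g) * h⁻¹ := by group
        _ = g * (h⁻¹ * x * h) * h⁻¹ := e.symm
        _ = g * h⁻¹ * x := by group
    let m := (theta Γ R u huR n).left
    have hmr : (theta Γ R u huR n).right = 1 := by
      apply Subtype.ext
      rw [theta_right, hrn]; rfl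
    have hm : theta Γ R u huR n = inl m := by
      ext
      · simp [m]
      · simp [hmr]
    have hm1 : m ≠ 1 := by
      intro h1
      apply hn1
      refine theta_inj huR hnS (one_mem _) ?_
      rw [hm, h1]; simp
    have hw : m.toWord ≠ [] := by
      rw [Ne, FreeGroup.toWord_eq_nil_iff]; exact hm1
    obtain ⟨q, s, hs⟩ := List.exists_cons_of_ne_nil hw
    obtain ⟨k, hk⟩ := QuotientGroup.mk_surjective q.1
    have key : ∀ x ∈ par Γ T, x * n = n * x →
        (k : RAAG Γ)⁻¹ * x * k ∈ par Γ (R ∩ Γ.neighborSet u) := by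
      intro x hx hxn
      have hxR := par_mono hTR hx
      have h3 : theta Γ R u huR x * theta Γ R u huR n = theta Γ R u huR n * theta Γ R u huR x := by
        rw [← map_mul, hxn, map_mul]
      have h4 : theta Γ R u huR x = inr ⟨x, hxR⟩ := theta_par huR ⟨x, hxR⟩
      rw [h4, hm] at h3
      have h5 := congrArg SemidirectProduct.left h3
      have h6 := act_fix (⟨x, hxR⟩ : par Γ R) m (by simpa using h5) q (by simp [hs])
      rw [← hk] at h6
      exact (smul_cos (R : Set V) u ⟨x, hxR⟩ k).1 h6
    have key2 : ∀ x ∈ par Γ T, x * n = n * x →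
        (ret Γ T k)⁻¹ * x * (ret Γ T k) ∈ par Γ (T ∩ Γ.neighborSet u) := by
      intro x hx hxn
      have := ret_mem_inter (S := T) (key x hx hxn)
      rw [map_mul, map_mul, map_inv, ret_par hx] at this
      refine par_mono ?_ this
      intro z hz
      exact ⟨hz.1, hz.2.2⟩
    have k1 := key2 b hb (hcomm b hb hb')
    have k2 := key2 d hd (hcomm d hd hd')
    obtain ⟨y, hy, w, hw, hyw, hnadj⟩ := exists_nonadj k1 k2 (by
      intro h7
      apply hbd
      have e1 : ∀ c : RAAG Γ, (c⁻¹ * b * c) * (c⁻¹ * d * c) = c⁻¹ * (b * d) * c := by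
        intro c; group
      have e2 : ∀ c : RAAG Γ, (c⁻¹ * d * c) * (c⁻¹ * b * c) = c⁻¹ * (d * b) * c := by
        intro c; group
      rw [e1, e2] at h7
      exact mul_left_cancel (mul_right_cancel h7))
    exact ⟨u, huS, huT, y, hy.1, w, hw.1, hy.2, hw.2, hyw, hnadj⟩

end R
end Kamb

namespace Kamb
section M
variable {V : Type*} {Γ : SimpleGraph V}

lemma solv_of_comm' {G : Type*} [Group G] (H : Subgroup G) (h : Group.IsSolvable (⁅H, H⁆ : Subgroup G)) :
    Group.IsSolvable H := by
  have h1 : Group.IsSolvable (commutator H) := by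
    refine Group.isSolvable_of_isSolvable_injective
      (f := (H.subtype.comp (commutator H).subtype).codRestrict ⁅H, H⁆ ?_) ?_
    · intro x
      rw [← Subgroup.map_subtype_commutator]
      exact ⟨x, x.2, rfl⟩
    · intro x y hxy
      have := congrArg Subtype.val hxy
      exact Subtype.ext (Subtype.ext this)
  refine Group.isSolvable_of_ker_le_range (commutator H).subtype (Abelianization.of (G := H)) ?_
  rw [Abelianization.ker_of, Subgroup.range_subtype]

lemma solv_sub {G : Type*} [Group G] {H K : Subgroup G} (hHK : H ≤ K) (h : Group.IsSolvable K) :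
    Group.IsSolvable H :=
  Group.isSolvable_of_isSolvable_injective (Subgroup.inclusion_injective hHK)

lemma exists_noncomm {G : Type*} [Group G] (H : Subgroup G) (h : ¬ Group.IsSolvable H) :
    ∃ p ∈ H, ∃ q ∈ H, p * q ≠ q * p := by
  by_contra hc
  push Not at hc
  exact h (Group.isSolvable_of_comm (fun a b => Subtype.ext (hc a a.2 b b.2)))

lemma exists_noncomm2 {G : Type*} [Group G] (H : Subgroup G) (h : ¬ Group.IsSolvable H) :
    ∃ p ∈ ⁅⁅H, H⁆, ⁅H, H⁆⁆, ∃ q ∈ ⁅⁅H, H⁆, ⁅H, H⁆⁆, p * q ≠ q * p :=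
  exists_noncomm _ (fun h' => h (solv_of_comm' _ (solv_of_comm' _ h')))

lemma nsolv_map {G G' : Type*} [Group G] [Group G'] (f : G →* G') (H : Subgroup G)
    (hf : ∀ x ∈ H, ∀ y ∈ H, f x = f y → x = y) (h : ¬ Group.IsSolvable H) : ¬ Group.IsSolvable (H.map f) := by
  intro h'
  apply h
  refine Group.isSolvable_of_isSolvable_injective (f := f.subgroupMap H) ?_
  intro x y hxy
  exact Subtype.ext (hf x x.2 y y.2 (congrArg Subtype.val hxy))

lemma nsolv_ker {G G' : Type*} [Group G] [Group G'] (f : G →* G') (H : Subgroup G)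
    (h : ¬ Group.IsSolvable H) (h' : Group.IsSolvable (H.map f)) : ¬ Group.IsSolvable (H ⊓ f.ker : Subgroup G) := by
  intro h2
  apply h
  refine Group.isSolvable_of_ker_le_range (Subgroup.inclusion (inf_le_left : H ⊓ f.ker ≤ H))
    (f.subgroupMap H) ?_
  intro x hx
  exact ⟨⟨x, x.2, congrArg Subtype.val hx⟩, rfl⟩

lemma step (R : Finset V) (v : V) (hv : v ∉ (R : Set V)) (A B : Subgroup (RAAG Γ))
    (hA : A ≤ par Γ (insert v (R : Set V))) (hB : B ≤ par Γ (insert v (R : Set V)))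
    (hAB : ∀ a ∈ A, ∀ b ∈ B, a * b = b * a)
    (nA : ¬ Group.IsSolvable A) (nB : ¬ Group.IsSolvable B) (hs : Group.IsSolvable (A.map (ret Γ R))) :
    HasInducedC4 Γ := by
  obtain ⟨a1, h1, a2, h2, h12⟩ := exists_noncomm _ (nsolv_ker _ A nA hs)
  have injA : ∀ x ∈ A, ∀ y ∈ A, theta Γ R v hv x = theta Γ R v hv y → x = y :=
    fun x hx y hy h => theta_inj hv (hA hx) (hA hy) h
  have injB : ∀ x ∈ B, ∀ y ∈ B, theta Γ R v hv x = theta Γ R v hv y → x = y :=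
    fun x hx y hy h => theta_inj hv (hB hx) (hB hy) h
  obtain ⟨y, x1, x2, hx, hc⟩ := core ((A ⊓ (ret Γ R).ker).map (theta Γ R v hv))
    (B.map (theta Γ R v hv))
    (by
      rintro _ ⟨a, ha, rfl⟩
      apply Subtype.ext
      rw [theta_right]
      exact ha.2)
    (theta Γ R v hv a1) (theta Γ R v hv a2) ⟨a1, h1, rfl⟩ ⟨a2, h2, rfl⟩
    (by
      rw [← map_mul, ← map_mul]
      intro h
      exact h12 (injA _ (mul_mem h1.1 h2.1) _ (mul_mem h2.1 h1.1) h))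
    (by
      rintro _ ⟨a, ha, rfl⟩ _ ⟨b, hb, rfl⟩
      rw [← map_mul, ← map_mul, hAB a ha.1 b hb])
  obtain ⟨p, hp, q, hq, hpq⟩ := exists_noncomm2 _ (nsolv_map _ B injB nB)
  obtain ⟨kp, ep, p1, p2⟩ := hc p hp
  obtain ⟨kq, eq, q1, q2⟩ := hc q hq
  have hk : (kp : RAAG Γ) * kq ≠ kq * kp := by
    intro h
    have h' : kp * kq = kq * kp := Subtype.ext h
    apply hpq
    have h3 := congrArg (SemidirectProduct.inr (φ := act (par Γ R) (Cos Γ R v))) h'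
    rw [map_mul, map_mul, ← ep, ← eq] at h3
    simp only [← mul_assoc, inv_mul_cancel_right, mul_left_inj] at h3
    rw [mul_assoc, mul_assoc] at h3
    exact mul_left_cancel h3
  obtain ⟨g1, rfl⟩ := QuotientGroup.mk_surjective x1
  obtain ⟨g2, rfl⟩ := QuotientGroup.mk_surjective x2
  rw [smul_cos] at p1 p2 q1 q2
  have e : ∀ k : RAAG Γ, ((g1 : RAAG Γ)⁻¹ * g2)⁻¹ * ((g1 : RAAG Γ)⁻¹ * k * g1) *
      ((g1 : RAAG Γ)⁻¹ * g2) = (g2 : RAAG Γ)⁻¹ * k * g2 := by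
    intro k; group
  obtain ⟨u, hu, huT, y, hy, w, hw, uy, uw, yw, nyw⟩ := lemma2 (Γ := Γ)
    ((R : Set V) ∩ Γ.neighborSet v) R Set.inter_subset_left
    ((g1 : RAAG Γ)⁻¹ * g2) _ _ (mul_mem (inv_mem g1.2) g2.2)
    (by
      intro h
      apply hx
      rw [QuotientGroup.eq, Subgroup.mem_subgroupOf]
      exact h) p1 q1
    (by
      intro h
      apply hk
      have h3 : (g1 : RAAG Γ)⁻¹ * (kp * kq) * g1 = (g1 : RAAG Γ)⁻¹ * (kq * kp) * g1 := by
        calc _ = (g1 : RAAG Γ)⁻¹ * kp * g1 * ((g1 : RAAG Γ)⁻¹ * kq * g1) := by group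
          _ = _ := h
          _ = _ := by group
      exact mul_left_cancel (mul_right_cancel h3))
    (by rw [e]; exact p2) (by rw [e]; exact q2)
  have vy : Γ.Adj v y := hy.2
  have vw : Γ.Adj v w := hw.2
  have nvu : ¬ Γ.Adj v u := fun h => huT ⟨hu, h⟩
  have hvu : v ≠ u := by rintro rfl; exact hv hu
  refine ⟨![v, y, u, w], ?_, ?_⟩
  · intro i j
    fin_cases i <;> fin_cases j <;>
      simp [hvu, hvu.symm, yw, yw.symm, vy.ne, vy.ne', vw.ne, vw.ne', uy.ne, uy.ne', uw.ne, uw.ne']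
  · have nuv : ¬ Γ.Adj u v := fun h => nvu h.symm
    have nwy : ¬ Γ.Adj w y := fun h => nyw h.symm
    intro i j
    rw [SimpleGraph.cycleGraph_adj]
    fin_cases i <;> fin_cases j <;>
      simp [vy, vw, uy, uw, vy.symm, vw.symm, uy.symm, uw.symm, nvu, nuv, nyw, nwy] <;> decide

lemma mainInd (S : Finset V) : ∀ (A B : Subgroup (RAAG Γ)),
    A ≤ par Γ S → B ≤ par Γ S → (∀ a ∈ A, ∀ b ∈ B, a * b = b * a) →
    ¬ Group.IsSolvable A → ¬ Group.IsSolvable B → HasInducedC4 Γ := by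
  classical
  induction S using Finset.induction_on with
  | empty =>
    intro A B hA _ _ nA _
    exfalso
    obtain ⟨p, hp, q, hq, hpq⟩ := exists_noncomm A nA
    obtain ⟨u, hu, _⟩ := exists_nonadj (hA hp) (hA hq) hpq
    simp at hu
  | insert v R hv ih =>
    intro A B hA hB hAB nA nB
    rw [Finset.coe_insert] at hA hB
    have hv' : v ∉ (R : Set V) := hv
    by_cases sA : Group.IsSolvable (A.map (ret Γ R))
    · exact step R v hv' A B hA hB hAB nA nB sA
    by_cases sB : Group.IsSolvable (B.map (ret Γ R))
    · exact step R v hv' B A hB hA (fun b hb a ha => (hAB a ha b hb).symm) nB nA sB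
    refine ih _ _ ?_ ?_ ?_ sA sB
    · rintro _ ⟨a, _, rfl⟩; exact ret_mem a
    · rintro _ ⟨a, _, rfl⟩; exact ret_mem a
    · rintro _ ⟨a, ha, rfl⟩ _ ⟨b, hb, rfl⟩
      rw [← map_mul, ← map_mul, hAB a ha b hb]

/-- two nonadjacent vertices generate a nonsolvable group -/
lemma nsolv_pair {W : Type*} {G : SimpleGraph W} (u w : W) (huw : u ≠ w) (h : ¬ G.Adj u w) :
    ¬ Group.IsSolvable (par G {u, w}) := by
  classical
  intro hs
  let F : W → Equiv.Perm (Fin 5) := fun x =>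
    if x = u then finRotate 5 else if x = w then Equiv.swap 0 1 else 1
  have hF : ∀ a b, G.Adj a b → Commute (F a) (F b) := by
    intro a b hab
    have hba := hab.symm
    by_cases h1 : a = u <;> by_cases h2 : b = u <;> by_cases h3 : a = w <;> by_cases h4 : b = w <;>
      simp_all [F]
  have hsurj : (par G {u, w}).map (rlift F hF) = ⊤ := by
    have hc : (finRotate 5).IsCycle := isCycle_finRotate
    have hsup : (finRotate 5).support = Finset.univ := support_finRotate
    have := Equiv.Perm.closure_cycle_adjacent_swap hc hsup 0
    rw [← this, par, MonoidHom.map_closure]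
    congr 1
    rw [Set.image_image, Set.image_pair]
    simp [F, huw.symm]
  apply Equiv.Perm.not_isSolvable_fin_5
  have e : Group.IsSolvable ((par G {u, w}).map (rlift F hF)) :=
    Group.isSolvable_of_surjective (MonoidHom.subgroupMap_surjective (rlift F hF) (par G {u, w}))
  rw [hsurj] at e
  exact Group.isSolvable_of_surjective (f := (⊤ : Subgroup (Equiv.Perm (Fin 5))).subtype)
    (fun x => ⟨⟨x, trivial⟩, rfl⟩)

end M
end Kamb

/-- Kambites. A right-angled Artin group `A(Γ)` contains a subgroup
isomorphic to `A(C₄)` if and only if `Γ` contains `C₄` as an induced subgraph. -/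
theorem stmt_13 {V : Type*} [Fintype V] (Γ : SimpleGraph V) :
    (∃ f : RAAG (SimpleGraph.cycleGraph 4) →* RAAG Γ, Function.Injective f) ↔
      HasInducedC4 Γ := by
  classical
  constructor
  · rintro ⟨f, hf⟩
    have hle : ∀ A : Subgroup (RAAG Γ), A ≤ Kamb.par Γ ((Finset.univ : Finset V) : Set V) := by
      intro A
      rw [Finset.coe_univ, Kamb.par_univ]
      exact le_top
    refine Kamb.mainInd (Γ := Γ) Finset.univ
      ((Kamb.par (SimpleGraph.cycleGraph 4) {0, 2}).map f)
      ((Kamb.par (SimpleGraph.cycleGraph 4) {1, 3}).map f) (hle _) (hle _) ?_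
      (Kamb.nsolv_map f _ (fun x _ y _ h => hf h) (Kamb.nsolv_pair 0 2 (by decide)
        (by rw [SimpleGraph.cycleGraph_adj]; decide)))
      (Kamb.nsolv_map f _ (fun x _ y _ h => hf h) (Kamb.nsolv_pair 1 3 (by decide)
        (by rw [SimpleGraph.cycleGraph_adj]; decide)))
    rintro _ ⟨a, ha, rfl⟩ _ ⟨b, hb, rfl⟩
    rw [← map_mul, ← map_mul]
    congr 1
    have h1 : ∀ u ∈ ({0, 2} : Set (Fin 4)), ∀ y ∈ Kamb.par (SimpleGraph.cycleGraph 4) {1, 3},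
        y ∈ Subgroup.centralizer {Kamb.gen (SimpleGraph.cycleGraph 4) u} := by
      intro u hu y hy
      refine Kamb.map_par_le (f := MonoidHom.id _) ?_ hy
      intro w hw
      rw [Subgroup.mem_centralizer_singleton_iff]
      refine (Kamb.gen_comm ?_).symm
      rw [SimpleGraph.cycleGraph_adj]
      rcases hu with rfl | rfl <;> rcases hw with rfl | rfl <;> decide
    have h2 : a ∈ Subgroup.centralizer {b} := by
      refine Kamb.map_par_le (f := MonoidHom.id _) ?_ ha
      intro w hw
      have := h1 w hw b hb
      rw [Subgroup.mem_centralizer_singleton_iff] at this ⊢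
      exact this.symm
    rw [Subgroup.mem_centralizer_singleton_iff] at h2
    exact h2
  · rintro ⟨φ, hφ, hadj⟩
    let f : RAAG (SimpleGraph.cycleGraph 4) →* RAAG Γ :=
      Kamb.rlift (fun i => Kamb.gen Γ (φ i)) (fun i j h => Kamb.gen_comm ((hadj i j).2 h))
    let F : V → RAAG (SimpleGraph.cycleGraph 4) := fun x =>
      if h : ∃ i, φ i = x then Kamb.gen _ h.choose else 1
    have hFφ : ∀ i, F (φ i) = Kamb.gen _ i := by
      intro i
      have h : ∃ j, φ j = φ i := ⟨i, rfl⟩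
      have h2 : h.choose = i := hφ h.choose_spec
      simp only [F, dif_pos h, h2]
    have hF : ∀ u v, Γ.Adj u v → Commute (F u) (F v) := by
      intro u v huv
      by_cases hu : ∃ i, φ i = u
      · by_cases hv : ∃ i, φ i = v
        · obtain ⟨i, rfl⟩ := hu
          obtain ⟨j, rfl⟩ := hv
          rw [hFφ, hFφ]
          exact Kamb.gen_comm ((hadj i j).1 huv)
        · simp only [F, dif_neg hv]; exact Commute.one_right _
      · simp only [F, dif_neg hu]; exact Commute.one_left _
    have hcomp : (Kamb.rlift F hF).comp f = MonoidHom.id _ := by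
      apply Kamb.hom_ext_gen
      intro i
      simp [f, hFφ]
    refine ⟨f, ?_⟩
    intro x y hxy
    have h1 := DFunLike.congr_fun hcomp x
    have h2 := DFunLike.congr_fun hcomp y
    simp only [MonoidHom.comp_apply, MonoidHom.id_apply] at h1 h2
    rw [← h1, ← h2, hxy]
end
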